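/- Let K be a finite set of finite smooth idempotent semilattice free algebras omitting type 1 that is closed under taking subalgebras, let R be a subdirect product of A1×...×An with A1,...,An in K, and let R' be a representation of R. Then R' generates R, i.e., Sg(R') = R. -/

import Mathlib

/-! Common framework: universal algebras over a fixed signature, terms,
subalgebras, congruences, quotients, edges and their types (Bulatov's
coloured-graph approach), thin edges, connectivity, products, etc. -/

/-- A (functional) signature: a type of operation symbols with arities. -/
structure Signature where
  ops : Type
  arity : ops → ℕ

/-- An algebra of a given signature. -/
structure UAlgebra (σ : Signature) where
  carrier : Type
  interp : ∀ f : σ.ops, (Fin (σ.arity f) → carrier) → carrier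

/-- Terms over the signature `σ` in `n` variables. -/
inductive Term (σ : Signature) (n : ℕ) where
  | var : Fin n → Term σ n
  | app : (f : σ.ops) → (Fin (σ.arity f) → Term σ n) → Term σ n

/-- Evaluation of a term in an algebra; term operations of an algebra are
exactly the operations of the form `Term.eval A t`. -/
def Term.eval {σ : Signature} {n : ℕ} (A : UAlgebra σ) :
    Term σ n → (Fin n → A.carrier) → A.carrier
  | .var i, x => x i
  | .app f ts, x => A.interp f fun j => Term.eval A (ts j) x

namespace UAlgebra

variable {σ : Signature}

/-- An algebra is idempotent if all its basic operations are. -/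
def Idempotent (A : UAlgebra σ) : Prop :=
  ∀ (f : σ.ops) (a : A.carrier), A.interp f (fun _ => a) = a

/-- A set closed under all basic operations. -/
def IsClosed (A : UAlgebra σ) (S : Set A.carrier) : Prop :=
  ∀ (f : σ.ops) (x : Fin (σ.arity f) → A.carrier), (∀ j, x j ∈ S) → A.interp f x ∈ S

/-- Closure of a set under the basic operations. -/
inductive Closure (A : UAlgebra σ) (S : Set A.carrier) : A.carrier → Prop
  | base {a : A.carrier} : a ∈ S → Closure A S a
  | app (f : σ.ops) (x : Fin (σ.arity f) → A.carrier) :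
      (∀ j, Closure A S (x j)) → Closure A S (A.interp f x)

def ClosureSet (A : UAlgebra σ) (S : Set A.carrier) : Set A.carrier := {x | Closure A S x}

theorem closureSet_isClosed (A : UAlgebra σ) (S : Set A.carrier) :
    A.IsClosed (A.ClosureSet S) := fun f x h => Closure.app f x h

/-- The subalgebra of `A` on a closed subset `S`. -/
def subalg (A : UAlgebra σ) (S : Set A.carrier) (hS : A.IsClosed S) : UAlgebra σ where
  carrier := {x : A.carrier // x ∈ S}
  interp f x := ⟨A.interp f fun j => (x j : A.carrier), hS f _ fun j => (x j).2⟩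

/-- The subalgebra generated by a set `S`. -/
def Sg (A : UAlgebra σ) (S : Set A.carrier) : UAlgebra σ :=
  A.subalg (A.ClosureSet S) (A.closureSet_isClosed S)

/-- `a` as an element of `Sg {a, b}`. -/
def sgA (A : UAlgebra σ) (a b : A.carrier) : (A.Sg {a, b}).carrier :=
  ⟨a, Closure.base (Set.mem_insert a {b})⟩

/-- `b` as an element of `Sg {a, b}`. -/
def sgB (A : UAlgebra σ) (a b : A.carrier) : (A.Sg {a, b}).carrier :=
  ⟨b, Closure.base (Set.mem_insert_iff.mpr (Or.inr rfl))⟩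

/-- A congruence of an algebra. -/
structure Congruence (A : UAlgebra σ) where
  rel : A.carrier → A.carrier → Prop
  refl : ∀ x, rel x x
  symm : ∀ {x y}, rel x y → rel y x
  trans : ∀ {x y z}, rel x y → rel y z → rel x z
  compat : ∀ (f : σ.ops) (x y : Fin (σ.arity f) → A.carrier),
      (∀ j, rel (x j) (y j)) → rel (A.interp f x) (A.interp f y)

def Congruence.toSetoid {A : UAlgebra σ} (θ : Congruence A) : Setoid A.carrier :=
  ⟨θ.rel, ⟨θ.refl, θ.symm, θ.trans⟩⟩

/-- The full congruence. -/
def Congruence.IsFull {A : UAlgebra σ} (θ : Congruence A) : Prop := ∀ x y, θ.rel x y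

def Congruence.le {A : UAlgebra σ} (θ η : Congruence A) : Prop :=
  ∀ x y, θ.rel x y → η.rel x y

/-- A maximal congruence: proper, and any congruence above it is full or below it. -/
def Congruence.IsMaximal {A : UAlgebra σ} (θ : Congruence A) : Prop :=
  ¬ θ.IsFull ∧ ∀ η : Congruence A, θ.le η → ¬ η.IsFull → η.le θ

/-- The quotient (factor) algebra. -/
noncomputable def quot (A : UAlgebra σ) (θ : Congruence A) : UAlgebra σ where
  carrier := Quotient θ.toSetoid
  interp f x := Quotient.mk θ.toSetoid (A.interp f fun j => (x j).out)

/-- The class of `a` in the quotient of `Sg {a,b}` by `θ`. -/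
def qa (A : UAlgebra σ) (a b : A.carrier) (θ : Congruence (A.Sg {a, b})) :
    ((A.Sg {a, b}).quot θ).carrier :=
  Quotient.mk θ.toSetoid (A.sgA a b)

def qb (A : UAlgebra σ) (a b : A.carrier) (θ : Congruence (A.Sg {a, b})) :
    ((A.Sg {a, b}).quot θ).carrier :=
  Quotient.mk θ.toSetoid (A.sgB a b)

end UAlgebra

/-- A binary operation is a semilattice operation on a set `B`. -/
def IsSemilatticeOn {α : Type} (f : α → α → α) (B : Set α) : Prop :=
  (∀ x ∈ B, f x x = x) ∧ (∀ x ∈ B, ∀ y ∈ B, f x y = f y x) ∧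
    (∀ x ∈ B, ∀ y ∈ B, ∀ z ∈ B, f x (f y z) = f (f x y) z)

/-- A ternary operation is a majority operation on a set `B`. -/
def IsMajorityOn {α : Type} (g : α → α → α → α) (B : Set α) : Prop :=
  ∀ x ∈ B, ∀ y ∈ B, g x x y = x ∧ g x y x = x ∧ g y x x = x

/-- A ternary operation is a Mal'tsev operation on a set `B`. -/
def IsMaltsevOn {α : Type} (h : α → α → α → α) (B : Set α) : Prop :=
  ∀ x ∈ B, ∀ y ∈ B, h x y y = x ∧ h y y x = x

namespace UAlgebra

variable {σ : Signature}

/-- An algebra is "a set": every term operation is a projection. -/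
def IsSetAlgebra (Q : UAlgebra σ) : Prop :=
  ∀ (n : ℕ) (t : Term σ n), ∃ i : Fin n, ∀ x : Fin n → Q.carrier, t.eval Q x = x i

/-- An algebra is the full idempotent reduct of a module over some finite ring:
its term operations are exactly the idempotent affine combinations; in
particular the affine operation `x - y + z` is a term operation. -/
def IsAffineAlgebra (Q : UAlgebra σ) : Prop :=
  ∃ (R : Type) (_ : Ring R) (_ : Finite R) (_ : AddCommGroup Q.carrier)
    (_ : Module R Q.carrier),
    (∀ (n : ℕ) (g : (Fin n → Q.carrier) → Q.carrier),
      (∃ t : Term σ n, ∀ x, t.eval Q x = g x) ↔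
      (∃ c : Fin n → R, (∑ i, c i) = 1 ∧ ∀ x, g x = ∑ i, c i • x i)) ∧
    (∃ t : Term σ 3, ∀ x y z : Q.carrier, t.eval Q ![x, y, z] = x - y + z)

/-- `θ` witnesses that `ab` is an edge of the unary type. -/
def UnaryWitness (A : UAlgebra σ) (a b : A.carrier) (θ : Congruence (A.Sg {a, b})) : Prop :=
  θ.IsMaximal ∧ IsSetAlgebra ((A.Sg {a, b}).quot θ)

/-- `θ` witnesses that `ab` is an edge of the semilattice type. -/
def SLWitness (A : UAlgebra σ) (a b : A.carrier) (θ : Congruence (A.Sg {a, b})) : Prop :=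
  θ.IsMaximal ∧ ∃ t : Term σ 2,
    IsSemilatticeOn (fun x y => t.eval ((A.Sg {a, b}).quot θ) ![x, y])
      {A.qa a b θ, A.qb a b θ}

/-- `θ` witnesses that `ab` is an edge of the majority type. -/
def MajWitness (A : UAlgebra σ) (a b : A.carrier) (θ : Congruence (A.Sg {a, b})) : Prop :=
  θ.IsMaximal ∧
  (∃ t : Term σ 3,
    IsMajorityOn (fun x y z => t.eval ((A.Sg {a, b}).quot θ) ![x, y, z])
      {A.qa a b θ, A.qb a b θ}) ∧
  ¬ (∃ t : Term σ 2,
    IsSemilatticeOn (fun x y => t.eval ((A.Sg {a, b}).quot θ) ![x, y])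
      {A.qa a b θ, A.qb a b θ})

/-- `θ` witnesses that `ab` is an edge of the affine type. -/
def AffWitness (A : UAlgebra σ) (a b : A.carrier) (θ : Congruence (A.Sg {a, b})) : Prop :=
  θ.IsMaximal ∧ IsAffineAlgebra ((A.Sg {a, b}).quot θ)

/-- A pair of distinct elements is an edge. -/
def IsEdge (A : UAlgebra σ) (a b : A.carrier) : Prop :=
  a ≠ b ∧ ∃ θ : Congruence (A.Sg {a, b}), ¬ θ.IsFull ∧
    (IsSetAlgebra ((A.Sg {a, b}).quot θ) ∨
     IsAffineAlgebra ((A.Sg {a, b}).quot θ) ∨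
     (∃ t : Term σ 2,
        IsSemilatticeOn (fun x y => t.eval ((A.Sg {a, b}).quot θ) ![x, y])
          {A.qa a b θ, A.qb a b θ}) ∨
     (∃ t : Term σ 3,
        IsMajorityOn (fun x y z => t.eval ((A.Sg {a, b}).quot θ) ![x, y, z])
          {A.qa a b θ, A.qb a b θ}))

def IsUnaryEdge (A : UAlgebra σ) (a b : A.carrier) : Prop :=
  a ≠ b ∧ ∃ θ : Congruence (A.Sg {a, b}), UnaryWitness A a b θ

def IsSLEdge (A : UAlgebra σ) (a b : A.carrier) : Prop :=
  a ≠ b ∧ ∃ θ : Congruence (A.Sg {a, b}), SLWitness A a b θ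

def IsMajEdge (A : UAlgebra σ) (a b : A.carrier) : Prop :=
  a ≠ b ∧ ∃ θ : Congruence (A.Sg {a, b}), MajWitness A a b θ

def IsAffEdge (A : UAlgebra σ) (a b : A.carrier) : Prop :=
  a ≠ b ∧ ∃ θ : Congruence (A.Sg {a, b}), AffWitness A a b θ

end UAlgebra

/-- The four types of edges. -/
inductive EdgeType where
  | unary | semilattice | majority | affine
deriving DecidableEq

namespace UAlgebra

variable {σ : Signature}

def HasEdgeOfType (A : UAlgebra σ) (τ : EdgeType) (a b : A.carrier) : Prop :=
  match τ with
  | .unary => A.IsUnaryEdge a b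
  | .semilattice => A.IsSLEdge a b
  | .majority => A.IsMajEdge a b
  | .affine => A.IsAffEdge a b

/-- `T`-restricted algebra: every edge has a type from `T`. -/
def Restricted (A : UAlgebra σ) (T : Set EdgeType) : Prop :=
  ∀ a b : A.carrier, A.IsEdge a b → ∃ τ ∈ T, A.HasEdgeOfType τ a b

/-- `A` omits type 1: no subalgebra of `A` has an edge of the unary type. -/
def OmitsType1 (A : UAlgebra σ) : Prop :=
  ∀ (S : Set A.carrier) (hS : A.IsClosed S) (a b : (A.subalg S hS).carrier),
    ¬ (A.subalg S hS).IsUnaryEdge a b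

/-- The union of the two `θ`-blocks of a thick edge, as a subset of `A`. -/
def edgeBlockUnion (A : UAlgebra σ) (a b : A.carrier) (θ : Congruence (A.Sg {a, b})) :
    Set A.carrier :=
  {x | ∃ hx : x ∈ A.ClosureSet {a, b},
    θ.rel ⟨x, hx⟩ (A.sgA a b) ∨ θ.rel ⟨x, hx⟩ (A.sgB a b)}

/-- Smooth algebra: for every semilattice- or majority-type edge with a witnessing
maximal congruence, the union of the two blocks is a subuniverse. -/
def IsSmooth (A : UAlgebra σ) : Prop :=
  ∀ (a b : A.carrier) (θ : Congruence (A.Sg {a, b})),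
    (SLWitness A a b θ ∨ MajWitness A a b θ) → A.IsClosed (A.edgeBlockUnion a b θ)

def SemilatticeFree (A : UAlgebra σ) : Prop := ∀ a b : A.carrier, ¬ A.IsSLEdge a b
def MajorityFree (A : UAlgebra σ) : Prop := ∀ a b : A.carrier, ¬ A.IsMajEdge a b
def AffineFree (A : UAlgebra σ) : Prop := ∀ a b : A.carrier, ¬ A.IsAffEdge a b

/-- Thin semilattice edge. -/
def IsThinSLEdge (A : UAlgebra σ) (a b : A.carrier) : Prop :=
  ∃ t : Term σ 2, t.eval A ![a, a] = a ∧ t.eval A ![a, b] = b ∧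
    t.eval A ![b, a] = b ∧ t.eval A ![b, b] = b

/-- Undirected thin majority edge: some term operation is majority on `{a, b}`. -/
def IsUndirThinMajEdge (A : UAlgebra σ) (a b : A.carrier) : Prop :=
  ∃ t : Term σ 3, IsMajorityOn (fun x y z => t.eval A ![x, y, z]) {a, b}

/-- Mal'tsev edge: some term operation is Mal'tsev on `{a, b}`. -/
def IsMaltsevEdge (A : UAlgebra σ) (a b : A.carrier) : Prop :=
  ∃ t : Term σ 3, IsMaltsevOn (fun x y z => t.eval A ![x, y, z]) {a, b}

/-- The class of all quotients of subalgebras of `A`. -/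
def QuotSub (A : UAlgebra σ) : Set (UAlgebra σ) :=
  {B | ∃ (S : Set A.carrier) (hS : A.IsClosed S)
        (θ : Congruence (A.subalg S hS)), B = (A.subalg S hS).quot θ}

end UAlgebra

/-- The class of all quotients of subalgebras of the algebras of a class. -/
def QuotSubClass {σ : Signature} (K : Set (UAlgebra σ)) : Set (UAlgebra σ) :=
  {B | ∃ A ∈ K, B ∈ UAlgebra.QuotSub A}

/-- A ternary term satisfies the majority condition relative to a class `𝒦`. -/
def MajorityCondition {σ : Signature} (𝒦 : Set (UAlgebra σ)) (t : Term σ 3) : Prop :=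
  (∀ B ∈ 𝒦, ∀ x y : B.carrier,
    t.eval B ![x, t.eval B ![x, y, y], t.eval B ![x, y, y]] = t.eval B ![x, y, y]) ∧
  (∀ B ∈ 𝒦, ∀ (a b : B.carrier) (θ : UAlgebra.Congruence (B.Sg {a, b})),
    a ≠ b → UAlgebra.MajWitness B a b θ →
    IsMajorityOn (fun x y z => t.eval ((B.Sg {a, b}).quot θ) ![x, y, z])
      {B.qa a b θ, B.qb a b θ})

/-- A ternary term satisfies the minority condition relative to a class `𝒦`. -/
def MinorityCondition {σ : Signature} (𝒦 : Set (UAlgebra σ)) (t : Term σ 3) : Prop :=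
  (∀ B ∈ 𝒦, ∀ x y : B.carrier,
    t.eval B ![t.eval B ![x, y, y], y, y] = t.eval B ![x, y, y]) ∧
  (∀ B ∈ 𝒦, ∀ (a b : B.carrier) (θ : UAlgebra.Congruence (B.Sg {a, b})),
    a ≠ b → UAlgebra.AffWitness B a b θ →
    IsMaltsevOn (fun x y z => t.eval ((B.Sg {a, b}).quot θ) ![x, y, z])
      {B.qa a b θ, B.qb a b θ})

/-- Thin majority edge relative to a class `𝒦`. -/
def IsThinMajEdge {σ : Signature} (𝒦 : Set (UAlgebra σ)) (A : UAlgebra σ)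
    (a b : A.carrier) : Prop :=
  ∀ t : Term σ 3, MajorityCondition 𝒦 t →
    b ∈ A.ClosureSet {a, t.eval A ![a, b, b]} ∧
    b ∈ A.ClosureSet {a, t.eval A ![b, a, b]} ∧
    b ∈ A.ClosureSet {a, t.eval A ![b, b, a]}

/-- Thin affine edge relative to a class `𝒦` (with respect to some fixed term
operation satisfying the minority condition). -/
def IsThinAffEdge {σ : Signature} (𝒦 : Set (UAlgebra σ)) (A : UAlgebra σ)
    (a b : A.carrier) : Prop :=
  (∃ t : Term σ 3, MinorityCondition 𝒦 t ∧ t.eval A ![b, a, a] = b) ∧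
  ∀ t : Term σ 3, MinorityCondition 𝒦 t → b ∈ A.ClosureSet {a, t.eval A ![a, a, b]}

namespace UAlgebra

variable {σ : Signature}

/-- Reachability in the digraph `Gs(A)` of thin semilattice edges. -/
def sReach (A : UAlgebra σ) : A.carrier → A.carrier → Prop :=
  Relation.ReflTransGen (fun x y => A.IsThinSLEdge x y)

/-- A maximal element of `Gs(A)`: an element of a maximal strongly connected
component. -/
def IsMaxElem (A : UAlgebra σ) (a : A.carrier) : Prop :=
  ∀ b, A.sReach a b → A.sReach b a

/-- A maximal component of `Gs(A)`: the strongly connected component of a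
maximal element. -/
def IsMaxComponent (A : UAlgebra σ) (C : Set A.carrier) : Prop :=
  ∃ a, A.IsMaxElem a ∧ C = {b | A.sReach a b ∧ A.sReach b a}

end UAlgebra

/-- An arc of the digraph `Gas(A)`: a thin semilattice or thin affine edge. -/
def asStep {σ : Signature} (𝒦 : Set (UAlgebra σ)) (A : UAlgebra σ)
    (x y : A.carrier) : Prop :=
  A.IsThinSLEdge x y ∨ IsThinAffEdge 𝒦 A x y

/-- Reachability in `Gas(A)`. -/
def asReach {σ : Signature} (𝒦 : Set (UAlgebra σ)) (A : UAlgebra σ) :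
    A.carrier → A.carrier → Prop :=
  Relation.ReflTransGen (asStep 𝒦 A)

/-- An as-maximal element: an element of an as-component. -/
def IsAsMaxElem {σ : Signature} (𝒦 : Set (UAlgebra σ)) (A : UAlgebra σ)
    (a : A.carrier) : Prop :=
  ∀ b, asReach 𝒦 A a b → asReach 𝒦 A b a

/-- An as-component of `A`: a maximal strongly connected component of `Gas(A)`. -/
def IsAsComponent {σ : Signature} (𝒦 : Set (UAlgebra σ)) (A : UAlgebra σ)
    (C : Set A.carrier) : Prop :=
  ∃ a, IsAsMaxElem 𝒦 A a ∧ C = {b | asReach 𝒦 A a b ∧ asReach 𝒦 A b a}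

namespace UAlgebra

variable {σ : Signature}

/-- Binary direct product. -/
def prod (A B : UAlgebra σ) : UAlgebra σ where
  carrier := A.carrier × B.carrier
  interp f x := (A.interp f fun j => (x j).1, B.interp f fun j => (x j).2)

/-- Direct product of a family. -/
def pi {ι : Type} (A : ι → UAlgebra σ) : UAlgebra σ where
  carrier := ∀ i, (A i).carrier
  interp f x := fun i => (A i).interp f fun j => x j i

/-- Homomorphism of similar algebras. -/
def IsHom (A B : UAlgebra σ) (φ : A.carrier → B.carrier) : Prop :=
  ∀ (f : σ.ops) (x : Fin (σ.arity f) → A.carrier),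
    φ (A.interp f x) = B.interp f fun j => φ (x j)

/-- Simple algebra: only the equality and full congruences. -/
def IsSimple (A : UAlgebra σ) : Prop :=
  ∀ θ : Congruence A, (∀ x y, θ.rel x y ↔ x = y) ∨ θ.IsFull

/-- Maximal generated algebra: generated by one of its maximal components. -/
def MaximalGenerated (A : UAlgebra σ) : Prop :=
  ∃ C : Set A.carrier, A.IsMaxComponent C ∧ A.ClosureSet C = Set.univ

/-- The number of subalgebras (nonempty closed subsets) of an algebra. -/
noncomputable def numSubalgebras (A : UAlgebra σ) : ℕ :=
  Nat.card {S : Set A.carrier // S.Nonempty ∧ A.IsClosed S}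

end UAlgebra

/-- A (k+3)-ary term is an edge term for a class `𝒦`. -/
def IsEdgeTermFor {σ : Signature} (𝒦 : Set (UAlgebra σ)) {k : ℕ}
    (t : Term σ (k + 3)) : Prop :=
  ∀ A ∈ 𝒦, ∀ x y : A.carrier,
    t.eval A (fun i => if i.val ≤ 1 then y else x) = x ∧
    t.eval A (fun i => if i.val = 0 ∨ i.val = 2 then y else x) = x ∧
    ∀ j : Fin (k + 3), 3 ≤ j.val →
      t.eval A (Function.update (fun _ => x) j y) = x

/-- A finite class has few subproducts. -/
def FewSubproducts {σ : Signature} (K : Set (UAlgebra σ)) : Prop :=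
  ∃ p : Polynomial ℕ, ∀ (n : ℕ) (A : Fin n → UAlgebra σ), (∀ i, A i ∈ K) →
    UAlgebra.numSubalgebras (UAlgebra.pi A) ≤ 2 ^ (p.eval n)

/-- `g_K` is bounded by a polynomial: every subalgebra of an `n`-fold product
of members of `K` has a generating set of polynomial size. -/
def PolyGenerated {σ : Signature} (K : Set (UAlgebra σ)) : Prop :=
  ∃ p : Polynomial ℕ, ∀ (n : ℕ) (A : Fin n → UAlgebra σ), (∀ i, A i ∈ K) →
    ∀ S : Set (UAlgebra.pi A).carrier, S.Nonempty → (UAlgebra.pi A).IsClosed S →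
      ∃ G : Set (UAlgebra.pi A).carrier, G ⊆ S ∧ G.Finite ∧
        G.ncard ≤ p.eval n ∧ (UAlgebra.pi A).ClosureSet G = S


namespace Term

variable {σ : Signature} {n m : ℕ}

/-- Substitution of terms for the variables of a term. -/
def subst : Term σ n → (Fin n → Term σ m) → Term σ m
  | .var i, s => s i
  | .app f ts, s => .app f fun j => (ts j).subst s

@[simp] theorem eval_var (A : UAlgebra σ) (i : Fin n) (x : Fin n → A.carrier) :
    (Term.var i : Term σ n).eval A x = x i := rfl

theorem eval_subst (A : UAlgebra σ) (t : Term σ n) (s : Fin n → Term σ m)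
    (x : Fin m → A.carrier) :
    (t.subst s).eval A x = t.eval A fun i => (s i).eval A x := by
  induction t with
  | var i => rfl
  | app f ts ih => simp only [subst, eval, ih]

/-- Composition of a binary term with two terms. -/
def comp₂ (t : Term σ 2) (a b : Term σ m) : Term σ m := t.subst ![a, b]

/-- Composition of a ternary term with three terms. -/
def comp₃ (t : Term σ 3) (a b c : Term σ m) : Term σ m := t.subst ![a, b, c]

theorem eval_congr₂ {A : UAlgebra σ} (t : Term σ 2) {x : Fin 2 → A.carrier} {a b : A.carrier}
    (h₀ : x 0 = a) (h₁ : x 1 = b) : t.eval A x = t.eval A ![a, b] := by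
  congr 1; funext i; fin_cases i <;> simpa

theorem eval_congr₃ {A : UAlgebra σ} (t : Term σ 3) {x : Fin 3 → A.carrier} {a b c : A.carrier}
    (h₀ : x 0 = a) (h₁ : x 1 = b) (h₂ : x 2 = c) : t.eval A x = t.eval A ![a, b, c] := by
  congr 1; funext i; fin_cases i <;> simpa

@[simp] theorem eval_comp₂ (A : UAlgebra σ) (t : Term σ 2) (a b : Term σ m)
    (x : Fin m → A.carrier) :
    (t.comp₂ a b).eval A x = t.eval A ![a.eval A x, b.eval A x] := by
  rw [comp₂, eval_subst]; exact eval_congr₂ t rfl rfl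

@[simp] theorem eval_comp₃ (A : UAlgebra σ) (t : Term σ 3) (a b c : Term σ m)
    (x : Fin m → A.carrier) :
    (t.comp₃ a b c).eval A x = t.eval A ![a.eval A x, b.eval A x, c.eval A x] := by
  rw [comp₃, eval_subst]; exact eval_congr₃ t rfl rfl rfl

/-- Iteration of a binary term in its second argument. -/
def iter (g : Term σ 2) : ℕ → Term σ 2
  | 0 => .var 1
  | k + 1 => g.comp₂ (.var 0) (g.iter k)

theorem eval_iter (A : UAlgebra σ) (g : Term σ 2) (k : ℕ) (z x : A.carrier) :
    (g.iter k).eval A ![z, x] = (fun v => g.eval A ![z, v])^[k] x := by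
  induction k with
  | zero => rfl
  | succ k ih => rw [iter, eval_comp₂, ih, Function.iterate_succ_apply']; rfl

theorem eval_const {A : UAlgebra σ} (hA : A.Idempotent) (t : Term σ n) (a : A.carrier) :
    t.eval A (fun _ => a) = a := by
  induction t with
  | var i => rfl
  | app f ts ih => simp only [eval, ih]; exact hA f a

theorem eval_const₂ {A : UAlgebra σ} (hA : A.Idempotent) (t : Term σ 2) (a : A.carrier) :
    t.eval A ![a, a] = a := by
  rw [← eval_congr₂ t (x := fun _ => a) rfl rfl, eval_const hA]

theorem eval_const₃ {A : UAlgebra σ} (hA : A.Idempotent) (t : Term σ 3) (a : A.carrier) :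
    t.eval A ![a, a, a] = a := by
  rw [← eval_congr₃ t (x := fun _ => a) rfl rfl rfl, eval_const hA]

end Term

namespace UAlgebra

variable {σ : Signature} {n : ℕ} {A B C : UAlgebra σ}

theorem IsClosed.eval_mem {S : Set A.carrier} (hS : A.IsClosed S) (t : Term σ n)
    {x : Fin n → A.carrier} (hx : ∀ i, x i ∈ S) : t.eval A x ∈ S := by
  induction t with
  | var i => exact hx i
  | app f ts ih => exact hS f _ ih

theorem IsClosed.eval_mem₂ {S : Set A.carrier} (hS : A.IsClosed S) (t : Term σ 2)
    {a b : A.carrier} (ha : a ∈ S) (hb : b ∈ S) : t.eval A ![a, b] ∈ S :=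
  hS.eval_mem t fun i => by fin_cases i <;> assumption

theorem IsClosed.eval_mem₃ {S : Set A.carrier} (hS : A.IsClosed S) (t : Term σ 3)
    {a b c : A.carrier} (ha : a ∈ S) (hb : b ∈ S) (hc : c ∈ S) :
    t.eval A ![a, b, c] ∈ S :=
  hS.eval_mem t fun i => by fin_cases i <;> assumption

theorem IsHom.eval {φ : A.carrier → B.carrier} (hφ : A.IsHom B φ) (t : Term σ n)
    (x : Fin n → A.carrier) : φ (t.eval A x) = t.eval B fun i => φ (x i) := by
  induction t with
  | var i => rfl
  | app f ts ih => simp only [Term.eval, hφ f, ih]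

theorem IsHom.eval₂ {φ : A.carrier → B.carrier} (hφ : A.IsHom B φ) (t : Term σ 2)
    (a b : A.carrier) : φ (t.eval A ![a, b]) = t.eval B ![φ a, φ b] := by
  rw [hφ.eval]; exact t.eval_congr₂ rfl rfl

theorem IsHom.eval₃ {φ : A.carrier → B.carrier} (hφ : A.IsHom B φ) (t : Term σ 3)
    (a b c : A.carrier) : φ (t.eval A ![a, b, c]) = t.eval B ![φ a, φ b, φ c] := by
  rw [hφ.eval]; exact t.eval_congr₃ rfl rfl rfl

theorem IsHom.comp {φ : A.carrier → B.carrier} {ψ : B.carrier → C.carrier}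
    (hψ : B.IsHom C ψ) (hφ : A.IsHom B φ) : A.IsHom C (ψ ∘ φ) := fun f x => by
  simp only [Function.comp, hφ f, hψ f]

theorem isHom_fst : (A.prod B).IsHom A Prod.fst := fun _ _ => rfl

theorem isHom_snd : (A.prod B).IsHom B Prod.snd := fun _ _ => rfl

theorem isHom_apply {ι : Type} (F : ι → UAlgebra σ) (i : ι) :
    (pi F).IsHom (F i) fun x => x i := fun _ _ => rfl

theorem isHom_val {S : Set A.carrier} (hS : A.IsClosed S) :
    (A.subalg S hS).IsHom A Subtype.val := fun _ _ => rfl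

/-- The canonical projection onto a quotient. -/
def toQuot (θ : Congruence A) (a : A.carrier) : (A.quot θ).carrier :=
  Quotient.mk θ.toSetoid a

theorem toQuot_eq_iff (θ : Congruence A) {a b : A.carrier} :
    toQuot θ a = toQuot θ b ↔ θ.rel a b :=
  ⟨fun h => Quotient.exact (s := θ.toSetoid) h, fun h => Quotient.sound (s := θ.toSetoid) h⟩

theorem toQuot_surjective (θ : Congruence A) : Function.Surjective (toQuot θ) :=
  fun q => Quotient.exists_rep q

theorem isHom_toQuot (θ : Congruence A) : A.IsHom (A.quot θ) (toQuot θ) := fun f x =>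
  (toQuot_eq_iff θ).2 (θ.compat f _ _ fun j =>
    θ.symm ((toQuot_eq_iff θ).1 (Quotient.out_eq (toQuot θ (x j)))))

theorem eval_prod (t : Term σ n) (x : Fin n → (A.prod B).carrier) :
    t.eval (A.prod B) x = (t.eval A fun i => (x i).1, t.eval B fun i => (x i).2) :=
  Prod.ext (isHom_fst.eval t x) (isHom_snd.eval t x)

theorem eval_pi {ι : Type} {F : ι → UAlgebra σ} (t : Term σ n) (x : Fin n → (pi F).carrier)
    (i : ι) : t.eval (pi F) x i = t.eval (F i) fun j => x j i :=
  (isHom_apply F i).eval t x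

theorem eval_pi₂ {ι : Type} {F : ι → UAlgebra σ} (t : Term σ 2) (x y : (pi F).carrier)
    (i : ι) : t.eval (pi F) ![x, y] i = t.eval (F i) ![x i, y i] :=
  (isHom_apply F i).eval₂ t x y

theorem eval_pi₃ {ι : Type} {F : ι → UAlgebra σ} (t : Term σ 3) (x y z : (pi F).carrier)
    (i : ι) : t.eval (pi F) ![x, y, z] i = t.eval (F i) ![x i, y i, z i] :=
  (isHom_apply F i).eval₃ t x y z

theorem Idempotent.of_surjective (hA : A.Idempotent) {φ : A.carrier → B.carrier}
    (hφ : A.IsHom B φ) (hs : Function.Surjective φ) : B.Idempotent := fun f b => by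
  obtain ⟨a, rfl⟩ := hs b
  rw [← hφ f fun _ => a, hA f a]

theorem Idempotent.of_injective (hB : B.Idempotent) {φ : A.carrier → B.carrier}
    (hφ : A.IsHom B φ) (hi : Function.Injective φ) : A.Idempotent := fun f a =>
  hi (by rw [hφ f, hB f])

theorem Idempotent.pi {ι : Type} {F : ι → UAlgebra σ} (hF : ∀ i, (F i).Idempotent) :
    (UAlgebra.pi F).Idempotent := fun f a => funext fun i => hF i f (a i)

theorem Idempotent.prod (hA : A.Idempotent) (hB : B.Idempotent) : (A.prod B).Idempotent :=
  fun f a => Prod.ext (hA f a.1) (hB f a.2)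

/-! ### Generated subuniverses -/

theorem isClosed_closureSet (S : Set A.carrier) : A.IsClosed (A.ClosureSet S) :=
  A.closureSet_isClosed S

theorem subset_closureSet (S : Set A.carrier) : S ⊆ A.ClosureSet S := fun _ h => Closure.base h

theorem closureSet_subset {S V : Set A.carrier} (hV : A.IsClosed V) (h : S ⊆ V) :
    A.ClosureSet S ⊆ V := fun x hx => by
  induction hx with
  | base ha => exact h ha
  | app f x _ ih => exact hV f x ih

theorem closureSet_pair_subset {a b : A.carrier} {V : Set A.carrier} (hV : A.IsClosed V)
    (ha : a ∈ V) (hb : b ∈ V) : A.ClosureSet {a, b} ⊆ V :=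
  closureSet_subset hV (Set.insert_subset ha (Set.singleton_subset_iff.2 hb))

theorem left_mem_closureSet (a b : A.carrier) : a ∈ A.ClosureSet {a, b} :=
  subset_closureSet _ (Set.mem_insert a {b})

theorem right_mem_closureSet (a b : A.carrier) : b ∈ A.ClosureSet {a, b} :=
  subset_closureSet _ (Set.mem_insert_of_mem a rfl)

theorem isClosed_range_eval (g : Fin n → A.carrier) :
    A.IsClosed {b | ∃ t : Term σ n, t.eval A g = b} := fun f x hx => by
  choose t ht using hx
  exact ⟨.app f t, by simp only [Term.eval, ht]⟩

theorem exists_eval_of_mem_pair {a b c : A.carrier} (h : c ∈ A.ClosureSet {a, b}) :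
    ∃ t : Term σ 2, t.eval A ![a, b] = c :=
  closureSet_pair_subset (isClosed_range_eval ![a, b]) ⟨.var 0, rfl⟩ ⟨.var 1, rfl⟩ h

theorem exists_eval_of_mem_triple {a b c d : A.carrier} (h : d ∈ A.ClosureSet {a, b, c}) :
    ∃ t : Term σ 3, t.eval A ![a, b, c] = d := by
  refine closureSet_subset (isClosed_range_eval ![a, b, c]) ?_ h
  rintro x (rfl | rfl | rfl)
  exacts [⟨.var 0, rfl⟩, ⟨.var 1, rfl⟩, ⟨.var 2, rfl⟩]

theorem IsClosed.preimage {V : Set B.carrier} (hV : B.IsClosed V) {φ : A.carrier → B.carrier}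
    (hφ : A.IsHom B φ) : A.IsClosed (φ ⁻¹' V) := fun f x hx => by
  rw [Set.mem_preimage, hφ f]; exact hV f _ hx

theorem IsClosed.image {V : Set A.carrier} (hV : A.IsClosed V) {φ : A.carrier → B.carrier}
    (hφ : A.IsHom B φ) : B.IsClosed (φ '' V) := fun f x hx => by
  choose y hy hyx using hx
  exact ⟨A.interp f y, hV f y hy, by simp only [hφ f, hyx]⟩

end UAlgebra


namespace UAlgebra

variable {σ : Signature} {A B : UAlgebra σ}

/-! ### Maximal congruences -/

/-- The equality congruence. -/
def Congruence.eq (A : UAlgebra σ) : Congruence A where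
  rel x y := x = y
  refl _ := rfl
  symm h := Eq.symm h
  trans h h' := Eq.trans h h'
  compat f x y h := by rw [funext h]

/-- The inverse image of a congruence under a homomorphism. -/
def Congruence.comap {φ : A.carrier → B.carrier} (hφ : A.IsHom B φ) (θ : Congruence B) :
    Congruence A where
  rel x y := θ.rel (φ x) (φ y)
  refl _ := θ.refl _
  symm h := θ.symm h
  trans h h' := θ.trans h h'
  compat f x y h := by rw [hφ f, hφ f]; exact θ.compat f _ _ h

theorem exists_isMaximal_congruence [Finite A.carrier] [Nontrivial A.carrier] :
    ∃ θ : Congruence A, θ.IsMaximal := by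
  have hfin : Finite (Congruence A) := by
    refine Finite.of_injective (fun θ : Congruence A => θ.rel) fun θ η h => ?_
    cases θ; cases η; simpa using h
  obtain ⟨a, b, hab⟩ := exists_pair_ne A.carrier
  have : Nonempty {θ : Congruence A // ¬ θ.IsFull} := ⟨⟨Congruence.eq A, fun h => hab (h a b)⟩⟩
  obtain ⟨θ, hθ⟩ := Finite.exists_max
    fun θ : {θ : Congruence A // ¬ θ.IsFull} => {p : A.carrier × A.carrier | θ.1.rel p.1 p.2}.ncard
  refine ⟨θ.1, θ.2, fun η hle hη x y hxy => ?_⟩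
  have hsub : {p : A.carrier × A.carrier | θ.1.rel p.1 p.2} ⊆ {p | η.rel p.1 p.2} :=
    fun p hp => hle _ _ hp
  have := Set.eq_of_subset_of_ncard_le hsub (hθ ⟨η, hη⟩) (Set.toFinite _)
  exact (Set.ext_iff.1 this (x, y)).2 hxy

theorem isSimple_quot {θ : Congruence A} (hθ : θ.IsMaximal) : (A.quot θ).IsSimple := by
  intro η
  by_cases hη : η.IsFull
  · exact Or.inr hη
  refine Or.inl fun x y => ⟨fun h => ?_, fun h => h ▸ η.refl x⟩
  obtain ⟨a, rfl⟩ := toQuot_surjective θ x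
  obtain ⟨b, rfl⟩ := toQuot_surjective θ y
  refine (toQuot_eq_iff θ).2 (hθ.2 (η.comap (isHom_toQuot θ)) ?_ ?_ a b h)
  · intro a b hab
    change η.rel _ _
    rw [(toQuot_eq_iff θ).2 hab]
    exact η.refl _
  · intro hfull
    refine hη fun x y => ?_
    obtain ⟨a, rfl⟩ := toQuot_surjective θ x
    obtain ⟨b, rfl⟩ := toQuot_surjective θ y
    exact hfull a b

/-! ### The absence of semilattice pairs -/

/-- No binary term operation acts on a pair of distinct elements as a semilattice operation. -/
def SLF (A : UAlgebra σ) : Prop :=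
  ∀ (a b : A.carrier) (t : Term σ 2), t.eval A ![a, b] = b → t.eval A ![b, a] = b → a = b

theorem SemilatticeFree.slf [Finite A.carrier] (hid : A.Idempotent) (h : A.SemilatticeFree) :
    A.SLF := by
  intro a b t h₁ h₂
  by_contra hab
  have : Finite (A.Sg {a, b}).carrier :=
    inferInstanceAs (Finite {x : A.carrier // x ∈ A.ClosureSet {a, b}})
  have : Nontrivial (A.Sg {a, b}).carrier :=
    ⟨A.sgA a b, A.sgB a b, fun h => hab (congrArg Subtype.val h)⟩
  obtain ⟨θ, hθ⟩ := exists_isMaximal_congruence (A := A.Sg {a, b})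
  have hv := isHom_val (A.closureSet_isClosed {a, b})
  have hq := isHom_toQuot θ
  have hidS : (A.Sg {a, b}).Idempotent := hid.of_injective hv Subtype.val_injective
  have hidQ : ((A.Sg {a, b}).quot θ).Idempotent :=
    hidS.of_surjective hq (toQuot_surjective θ)
  have e₁ : t.eval ((A.Sg {a, b}).quot θ) ![A.qa a b θ, A.qb a b θ] = A.qb a b θ := by
    have : t.eval (A.Sg {a, b}) ![A.sgA a b, A.sgB a b] = A.sgB a b :=
      Subtype.ext ((hv.eval₂ t _ _).trans h₁)
    exact (hq.eval₂ t _ _).symm.trans (congrArg (toQuot θ) this)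
  have e₂ : t.eval ((A.Sg {a, b}).quot θ) ![A.qb a b θ, A.qa a b θ] = A.qb a b θ := by
    have : t.eval (A.Sg {a, b}) ![A.sgB a b, A.sgA a b] = A.sgB a b :=
      Subtype.ext ((hv.eval₂ t _ _).trans h₂)
    exact (hq.eval₂ t _ _).symm.trans (congrArg (toQuot θ) this)
  have e₃ := fun x => Term.eval_const₂ hidQ t x
  refine h a b ⟨hab, θ, hθ, t, fun x _ => e₃ x, ?_, ?_⟩
  · rintro x (rfl | rfl) y (rfl | rfl) <;> simp only [e₁, e₂]
  · rintro x (rfl | rfl) y (rfl | rfl) z (rfl | rfl) <;> simp only [e₁, e₂, e₃]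

theorem exists_iterate_fixed {α : Type*} [Finite α] (ρ : α → α) (z : α) :
    ∃ m k, ρ^[k + 1] (ρ^[m] z) = ρ^[m] z := by
  obtain ⟨i, j, hij, h⟩ := Finite.exists_ne_map_eq_of_infinite fun i : ℕ => ρ^[i] z
  wlog hlt : i < j generalizing i j
  · exact this j i hij.symm h.symm (lt_of_le_of_ne (not_lt.1 hlt) hij.symm)
  refine ⟨i, j - i - 1, ?_⟩
  rw [← Function.iterate_add_apply]
  have : j - i - 1 + 1 + i = j := by omega
  rw [this]; exact h.symm

/-- In a finite algebra without semilattice pairs, a nonempty set `P` such that `g(x, P) ⊆ P` and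
`P` contains all the iterates of `g(z, ·)` at `x` for `z ∈ P` must contain `x`. -/
theorem SLF.mem_of_absorbs [Finite A.carrier] (h : A.SLF) (hid : A.Idempotent)
    {x : A.carrier} {P : Set A.carrier} (hP : P.Nonempty) (g : Term σ 2)
    (h₁ : ∀ z ∈ P, g.eval A ![x, z] ∈ P)
    (h₂ : ∀ z ∈ P, ∀ k : ℕ, (fun v => g.eval A ![z, v])^[k + 1] x ∈ P) : x ∈ P := by
  obtain ⟨z, hz, hmin⟩ := Set.exists_min_image P (fun z => (A.ClosureSet {x, z}).ncard)
    P.toFinite hP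
  obtain ⟨m, k, hk⟩ := exists_iterate_fixed (fun v => g.eval A ![x, v]) z
  set z' := (fun v => g.eval A ![x, v])^[m] z with hz'
  have hiter : ∀ {V : Set A.carrier}, A.IsClosed V → ∀ {u v}, u ∈ V → v ∈ V → ∀ k,
      (fun v => g.eval A ![u, v])^[k] v ∈ V := fun hV u v hu hv k => by
    rw [← Term.eval_iter]; exact hV.eval_mem₂ _ hu hv
  have hz'P : z' ∈ P := by
    have : ∀ m, (fun v => g.eval A ![x, v])^[m] z ∈ P := fun m => by
      induction m with
      | zero => exact hz
      | succ m ih => rw [Function.iterate_succ_apply']; exact h₁ _ ih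
    exact this m
  have hz'c : z' ∈ A.ClosureSet {x, z} :=
    hiter (isClosed_closureSet _) (left_mem_closureSet _ _) (right_mem_closureSet _ _) m
  set e := (fun v => g.eval A ![z', v])^[k + 1] x with he
  have heP : e ∈ P := h₂ _ hz'P k
  have hec : A.ClosureSet {x, e} ⊆ A.ClosureSet {x, z'} :=
    closureSet_pair_subset (isClosed_closureSet _) (left_mem_closureSet _ _)
      (hiter (isClosed_closureSet _) (right_mem_closureSet _ _) (left_mem_closureSet _ _) _)
  have hzc : A.ClosureSet {x, z'} ⊆ A.ClosureSet {x, z} :=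
    closureSet_pair_subset (isClosed_closureSet _) (left_mem_closureSet _ _) hz'c
  have heq : A.ClosureSet {x, e} = A.ClosureSet {x, z'} :=
    Set.eq_of_subset_of_ncard_le hec
      ((Set.ncard_le_ncard hzc (Set.toFinite _)).trans (hmin e heP)) (Set.toFinite _)
  obtain ⟨r, hr⟩ := exists_eval_of_mem_pair (heq ▸ right_mem_closureSet x z' :
    z' ∈ A.ClosureSet {x, e})
  have hxz : x = z' := by
    refine h x z' (r.comp₂ (.var 0) ((g.iter (k + 1)).comp₂ (.var 1) (.var 0))) ?_ ?_
    · rw [Term.eval_comp₂, Term.eval_comp₂]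
      simp only [Term.eval_var, Matrix.cons_val_zero, Matrix.cons_val_one]
      rw [Term.eval_iter]; exact hr
    · rw [Term.eval_comp₂, Term.eval_comp₂]
      simp only [Term.eval_var, Matrix.cons_val_zero, Matrix.cons_val_one]
      rw [Term.eval_iter, hk, Term.eval_const₂ hid]
  rw [hxz]; exact hz'P

/-- A version of `SLF.mem_of_absorbs` for sets of values of terms. -/
theorem SLF.exists_term_of_absorbs [Finite A.carrier] (h : A.SLF) (hid : A.Idempotent) {n : ℕ}
    (y : Fin n → A.carrier) (i : Fin n) {good weak : Term σ n → Prop} (hne : ∃ t, good t)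
    (g : Term σ 2)
    (h₁ : ∀ t, good t → ∃ t', good t' ∧ t'.eval A y = g.eval A ![y i, t.eval A y])
    (hw : weak (.var i)) (hgw : ∀ t, good t → weak t)
    (h₂ : ∀ t s, good t → weak s → good (g.comp₂ t s)) :
    ∃ t, good t ∧ t.eval A y = y i := by
  refine h.mem_of_absorbs hid (x := y i) (P := {z | ∃ t, good t ∧ t.eval A y = z}) ?_ g ?_ ?_
  · obtain ⟨t, ht⟩ := hne
    exact ⟨_, t, ht, rfl⟩
  · rintro _ ⟨t, ht, rfl⟩
    exact h₁ t ht
  · rintro _ ⟨t, ht, rfl⟩ k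
    induction k with
    | zero => exact ⟨_, h₂ t _ ht hw, by simp⟩
    | succ k ih =>
      obtain ⟨s, hs, hsk⟩ := ih
      rw [Function.iterate_succ_apply']
      exact ⟨_, h₂ t s ht (hgw s hs), by simp [hsk]⟩

theorem SLF.of_injective (hB : B.SLF) {φ : A.carrier → B.carrier} (hφ : A.IsHom B φ)
    (hi : Function.Injective φ) : A.SLF := fun a b t h₁ h₂ =>
  hi (hB _ _ t (by rw [← hφ.eval₂, h₁]) (by rw [← hφ.eval₂, h₂]))

theorem SLF.pi {ι : Type} {F : ι → UAlgebra σ} (hF : ∀ i, (F i).SLF) : (UAlgebra.pi F).SLF :=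
  fun a b t h₁ h₂ => funext fun i => hF i (a i) (b i) t
    (by rw [← eval_pi₂, h₁]) (by rw [← eval_pi₂, h₂])

theorem SLF.of_surjective [Finite A.carrier] (hA : A.SLF) (hid : A.Idempotent)
    {φ : A.carrier → B.carrier}
    (hφ : A.IsHom B φ) (hs : Function.Surjective φ) : B.SLF := by
  intro a b t h₁ h₂
  obtain ⟨x, rfl⟩ := hs a
  obtain ⟨y, rfl⟩ := hs b
  refine hA.mem_of_absorbs hid (P := {z | φ z = φ y}) ⟨y, rfl⟩ t (fun z hz => ?_) fun z hz k => ?_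
  · rw [Set.mem_ofPred_eq] at hz ⊢
    rw [hφ.eval₂, hz, h₁]
  · rw [Set.mem_ofPred_eq] at hz ⊢
    induction k with
    | zero => simp only [zero_add, Function.iterate_one]; rw [hφ.eval₂, hz, h₂]
    | succ k ih =>
      rw [Function.iterate_succ_apply', hφ.eval₂, ih, hz]
      exact Term.eval_const₂ (hid.of_surjective hφ hs) t _

end UAlgebra


namespace UAlgebra

variable {σ : Signature} {κ : Type} {E : κ → UAlgebra σ} {C : UAlgebra σ}

/-! ### Identities of a family of algebras -/

/-- `C` satisfies all the identities of the family `E`. -/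
def Sat (E : κ → UAlgebra σ) (C : UAlgebra σ) : Prop :=
  ∀ (n : ℕ) (s t : Term σ n), (∀ k x, s.eval (E k) x = t.eval (E k) x) →
    ∀ x, s.eval C x = t.eval C x

theorem sat_self (E : κ → UAlgebra σ) (k : κ) : Sat E (E k) := fun _ _ _ h => h k

theorem Sat.of_injective {A B : UAlgebra σ} (hB : Sat E B) {φ : A.carrier → B.carrier}
    (hφ : A.IsHom B φ) (hi : Function.Injective φ) : Sat E A := fun n s t h x =>
  hi (by rw [hφ.eval, hφ.eval, hB n s t h])

theorem Sat.of_surjective {A B : UAlgebra σ} (hA : Sat E A) {φ : A.carrier → B.carrier}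
    (hφ : A.IsHom B φ) (hs : Function.Surjective φ) : Sat E B := fun n s t h x => by
  choose y hy using fun i => hs (x i)
  rw [← funext hy, ← hφ.eval, ← hφ.eval, hA n s t h]

/-- The power of the family `E` in which two elements freely generate the two-generated
free algebra of the variety generated by `E`. -/
def freePower (E : κ → UAlgebra σ) : UAlgebra σ :=
  pi fun i : Σ k, (E k).carrier × (E k).carrier => E i.1

/-- The first free generator. -/
def gx (E : κ → UAlgebra σ) : (freePower E).carrier := fun i => i.2.1

/-- The second free generator. -/
def gy (E : κ → UAlgebra σ) : (freePower E).carrier := fun i => i.2.2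

instance [Finite κ] [∀ k, Finite (E k).carrier] : Finite (freePower E).carrier :=
  inferInstanceAs (Finite (∀ i : Σ k, (E k).carrier × (E k).carrier, (E i.1).carrier))

theorem idempotent_freePower (hid : ∀ k, (E k).Idempotent) : (freePower E).Idempotent :=
  Idempotent.pi fun _ => hid _

theorem slf_freePower (hslf : ∀ k, (E k).SLF) : (freePower E).SLF :=
  SLF.pi fun _ => hslf _

/-- A ternary term with `p(x, y, y) = x` on all algebras of the family. -/
def IsLeftMaltsev (E : κ → UAlgebra σ) (p : Term σ 3) : Prop :=
  ∀ k (x y : (E k).carrier), p.eval (E k) ![x, y, y] = x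

theorem isLeftMaltsev_of_eval_gx {p : Term σ 3}
    (h : p.eval (freePower E) ![gx E, gy E, gy E] = gx E) : IsLeftMaltsev E p := fun k x y =>
  (eval_pi₃ p _ _ _ (⟨k, x, y⟩ : Σ k, (E k).carrier × (E k).carrier)).symm.trans (congrFun h _)

theorem IsLeftMaltsev.eval_sat {p : Term σ 3} (h : IsLeftMaltsev E p) (hC : Sat E C)
    (x y : C.carrier) : p.eval C ![x, y, y] = x := by
  have := hC 2 (p.comp₃ (.var 0) (.var 1) (.var 1)) (.var 0)
    (fun k x => by simpa using h k (x 0) (x 1)) ![x, y]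
  simpa using this

theorem IsLeftMaltsev.eval_pi {ι : Type} {e : ι → κ} {p : Term σ 3} (h : IsLeftMaltsev E p)
    (x y : (pi fun i => E (e i)).carrier) : p.eval (pi fun i => E (e i)) ![x, y, y] = x :=
  funext fun i => (eval_pi₃ p _ _ _ i).trans (h _ _ _)

/-- Two left Mal'tsev terms are joined so that the result inherits the right Mal'tsev
identity from either of them. -/
def joinTerm (p p' : Term σ 3) : Term σ 3 :=
  p'.comp₃ p (p.comp₃ (.var 1) (.var 1) (.var 2)) (.var 2)

theorem IsLeftMaltsev.join {p p' : Term σ 3}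
    (h : IsLeftMaltsev E p) (h' : IsLeftMaltsev E p') : IsLeftMaltsev E (joinTerm p p') :=
  fun k x y => by simp [joinTerm, h k, h' k]

theorem eval_joinTerm_eq (p p' : Term σ 3) (e b : C.carrier) :
    (joinTerm p p').eval C ![e, e, b] =
      p'.eval C ![p.eval C ![e, e, b], p.eval C ![e, e, b], b] := by
  simp [joinTerm]

theorem exists_isLeftMaltsev_forall [Finite C.carrier]
    (hC : C.Idempotent)
    (h : ∀ e b : C.carrier, ∃ p, IsLeftMaltsev E p ∧ p.eval C ![e, e, b] = b) :
    ∃ p, IsLeftMaltsev E p ∧ ∀ e b : C.carrier, p.eval C ![e, e, b] = b := by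
  classical
  have key : ∀ s : Finset (C.carrier × C.carrier), ∃ p, IsLeftMaltsev E p ∧
      ∀ x ∈ s, p.eval C ![x.1, x.1, x.2] = x.2 := by
    intro s
    induction s using Finset.induction_on with
    | empty => exact ⟨.var 0, fun _ _ _ => rfl, by simp⟩
    | insert x s _ ih =>
      obtain ⟨p, hp, hps⟩ := ih
      obtain ⟨p', hp', h'⟩ := h (p.eval C ![x.1, x.1, x.2]) x.2
      refine ⟨joinTerm p p', hp.join hp', fun y hy => ?_⟩
      rw [eval_joinTerm_eq]
      rcases Finset.mem_insert.1 hy with rfl | hy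
      · exact h'
      · rw [hps y hy, Term.eval_const₃ hC]
  have := Fintype.ofFinite C.carrier
  obtain ⟨p, hp, h'⟩ := key Finset.univ
  exact ⟨p, hp, fun e b => h' (e, b) (Finset.mem_univ _)⟩

theorem exists_isLeftMaltsev_universal [Finite κ] [∀ k, Finite (E k).carrier] :
    ∃ p, IsLeftMaltsev E p ∧ ∀ C : UAlgebra σ, C.Idempotent → Sat E C →
      (∃ p', IsLeftMaltsev E p' ∧ ∀ e b : C.carrier, p'.eval C ![e, e, b] = b) →
      ∀ e b : C.carrier, p.eval C ![e, e, b] = b := by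
  classical
  have key : ∀ s : Finset (freePower E).carrier, ∃ p, IsLeftMaltsev E p ∧
      ∀ C : UAlgebra σ, C.Idempotent → Sat E C →
      (∃ p', IsLeftMaltsev E p' ∧ p'.eval (freePower E) ![gx E, gx E, gy E] ∈ s ∧
        ∀ e b : C.carrier, p'.eval C ![e, e, b] = b) →
      ∀ e b : C.carrier, p.eval C ![e, e, b] = b := by
    intro s
    induction s using Finset.induction_on with
    | empty => exact ⟨.var 0, fun _ _ _ => rfl, by simp⟩
    | insert z s _ ih =>
      obtain ⟨p, hp, hps⟩ := ih
      by_cases hz : ∃ p', IsLeftMaltsev E p' ∧ p'.eval (freePower E) ![gx E, gx E, gy E] = z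
      · obtain ⟨p', hp', hz'⟩ := hz
        refine ⟨joinTerm p p', hp.join hp', fun C hC hS ⟨p'', hp'', hmem, h''⟩ e b => ?_⟩
        rw [eval_joinTerm_eq]
        rcases Finset.mem_insert.1 hmem with hmem | hmem
        · set d := p.eval C ![e, e, b]
          have := hS 2 (p'.comp₃ (.var 0) (.var 0) (.var 1)) (p''.comp₃ (.var 0) (.var 0) (.var 1))
            (fun k x => by
              have := congrFun (hz'.trans hmem.symm)
                (⟨k, x 0, x 1⟩ : Σ k, (E k).carrier × (E k).carrier)
              have := (eval_pi₃ p' _ _ _ _).symm.trans (this.trans (eval_pi₃ p'' _ _ _ _))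
              simp only [gx, gy] at this
              simpa using this)
            ![d, b]
          simp only [Term.eval_comp₃, Term.eval_var, Matrix.cons_val_zero,
            Matrix.cons_val_one] at this
          rw [this, h'']
        · rw [hps C hC hS ⟨p'', hp'', hmem, h''⟩, Term.eval_const₃ hC]
      · refine ⟨p, hp, fun C hC hS ⟨p'', hp'', hmem, h''⟩ => ?_⟩
        rcases Finset.mem_insert.1 hmem with hmem | hmem
        · exact absurd ⟨p'', hp'', hmem⟩ hz
        · exact hps C hC hS ⟨p'', hp'', hmem, h''⟩
  have := Fintype.ofFinite (freePower E).carrier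
  obtain ⟨p, hp, h⟩ := key Finset.univ
  exact ⟨p, hp, fun C hC hS ⟨p', hp', h'⟩ => h C hC hS ⟨p', hp', Finset.mem_univ _, h'⟩⟩

/-- A Mal'tsev term of `C` can be improved to one which is left Mal'tsev on the family `E`. -/
theorem exists_isLeftMaltsev_of_maltsev [Finite κ] [∀ k, Finite (E k).carrier]
    (hid : ∀ k, (E k).Idempotent) (hslf : ∀ k, (E k).SLF) [Finite C.carrier]
    (hC : C.Idempotent) (q : Term σ 3)
    (hq : ∀ x y : C.carrier, q.eval C ![x, y, y] = x ∧ q.eval C ![y, y, x] = x) :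
    ∃ p, IsLeftMaltsev E p ∧ ∀ e b : C.carrier, p.eval C ![e, e, b] = b := by
  refine exists_isLeftMaltsev_forall hC fun e b => ?_
  obtain ⟨p, hp, h⟩ : ∃ t : Term σ 3, t.eval C ![e, e, b] = b ∧
      t.eval (freePower E) ![gx E, gy E, gy E] = gx E := by
    refine (slf_freePower hslf).exists_term_of_absorbs (idempotent_freePower hid)
      ![gx E, gy E, gy E] 0 (weak := fun _ => True)
      ⟨.var 2, rfl⟩ (q.comp₃ (.var 0) (.var 1) (.var 1)) ?_ trivial (fun _ _ => trivial) ?_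
    · intro t ht
      refine ⟨q.comp₃ (.var 0) (t.comp₃ (.var 0) (.var 1) (.var 1)) t, ?_, ?_⟩
      · simp [ht, Term.eval_const₃ hC, (hq _ _).2]
      · simp
    · intro t s ht _
      simp [ht, (hq _ _).1]
  exact ⟨p, isLeftMaltsev_of_eval_gx h, hp⟩

end UAlgebra


namespace UAlgebra

variable {σ : Signature} {A B C : UAlgebra σ}

/-! ### Affine algebras -/

/-- `C` has a Mal'tsev term operation which commutes with all basic operations. -/
def CentralMaltsev (C : UAlgebra σ) : Prop :=
  ∃ p : Term σ 3,
    (∀ x y : C.carrier, p.eval C ![x, y, y] = x ∧ p.eval C ![y, y, x] = x) ∧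
    ∀ (f : σ.ops) (x y z : Fin (σ.arity f) → C.carrier),
      p.eval C ![C.interp f x, C.interp f y, C.interp f z] =
        C.interp f fun j => p.eval C ![x j, y j, z j]

theorem CentralMaltsev.of_surjective (h : CentralMaltsev A) {φ : A.carrier → B.carrier}
    (hφ : A.IsHom B φ) (hs : Function.Surjective φ) : CentralMaltsev B := by
  obtain ⟨p, hp, hc⟩ := h
  refine ⟨p, fun x y => ?_, fun f x y z => ?_⟩
  · obtain ⟨x, rfl⟩ := hs x
    obtain ⟨y, rfl⟩ := hs y
    rw [← hφ.eval₃, ← hφ.eval₃, (hp x y).1, (hp x y).2]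
    exact ⟨rfl, rfl⟩
  · choose x' hx using fun i => hs (x i)
    choose y' hy using fun i => hs (y i)
    choose z' hz using fun i => hs (z i)
    rw [← funext hx, ← funext hy, ← funext hz, ← hφ f, ← hφ f, ← hφ f, ← hφ.eval₃, hc, hφ f]
    simp only [hφ.eval₃]

theorem CentralMaltsev.of_injective (h : CentralMaltsev B) {φ : A.carrier → B.carrier}
    (hφ : A.IsHom B φ) (hi : Function.Injective φ) : CentralMaltsev A := by
  obtain ⟨p, hp, hc⟩ := h
  refine ⟨p, fun x y => ⟨hi ?_, hi ?_⟩, fun f x y z => hi ?_⟩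
  · rw [hφ.eval₃, (hp _ _).1]
  · rw [hφ.eval₃, (hp _ _).2]
  · simp only [hφ.eval₃, hφ f, hc]

section Affine

variable [AddCommGroup C.carrier]

theorem eval_add (hadd : ∀ (f : σ.ops) (x y : Fin (σ.arity f) → C.carrier),
      C.interp f (x + y) = C.interp f x + C.interp f y) {n : ℕ} (t : Term σ n)
    (x y : Fin n → C.carrier) : t.eval C (x + y) = t.eval C x + t.eval C y := by
  induction t with
  | var i => rfl
  | app f ts ih =>
    simp only [Term.eval, ih]
    exact hadd f _ _

theorem eval_eq_add_of_add (hid : C.Idempotent)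
    (hadd : ∀ (f : σ.ops) (x y : Fin (σ.arity f) → C.carrier),
      C.interp f (x + y) = C.interp f x + C.interp f y) (t : Term σ 2) (u v : C.carrier) :
    t.eval C ![u, v] = u + t.eval C ![0, v - u] := by
  have := eval_add hadd t ![u, u] ![0, v - u]
  rw [Term.eval_const₂ hid] at this
  rw [← this]
  congr 1
  funext i; fin_cases i <;> simp

/-- The ring of the multiplications by scalars which are term operations. -/
def scalarRing (p : Term σ 3) (hp : ∀ x y z : C.carrier, p.eval C ![x, y, z] = x - y + z) :
    Subring (AddMonoid.End C.carrier) where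
  carrier := {r | ∃ f : Term σ 2, ∀ y, f.eval C ![0, y] = r y}
  zero_mem' := ⟨.var 0, fun _ => rfl⟩
  one_mem' := ⟨.var 1, fun _ => rfl⟩
  add_mem' := by
    rintro r s ⟨f, hf⟩ ⟨g, hg⟩
    exact ⟨p.comp₃ f (.var 0) g, fun y => by simp [hp, hf, hg]; rfl⟩
  neg_mem' := by
    rintro r ⟨f, hf⟩
    exact ⟨p.comp₃ (.var 0) f (.var 0), fun y => by simp [hp, hf]; rfl⟩
  mul_mem' := by
    rintro r s ⟨f, hf⟩ ⟨g, hg⟩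
    exact ⟨f.comp₂ (.var 0) g, fun y => by simp [hf, hg]⟩

theorem isAffineAlgebra_of_add [Finite C.carrier] [Nontrivial C.carrier] (hid : C.Idempotent)
    (p : Term σ 3) (hp : ∀ x y z : C.carrier, p.eval C ![x, y, z] = x - y + z)
    (hadd : ∀ (f : σ.ops) (x y : Fin (σ.arity f) → C.carrier),
      C.interp f (x + y) = C.interp f x + C.interp f y) : IsAffineAlgebra C := by
  classical
  have hfinite : Finite (AddMonoid.End C.carrier) :=
    Finite.of_injective (fun r : AddMonoid.End C.carrier => (r : C.carrier → C.carrier))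
      DFunLike.coe_injective
  refine ⟨scalarRing p hp, inferInstance, inferInstance, inferInstance, inferInstance,
    fun n g => ⟨?_, ?_⟩, p, hp⟩
  · rintro ⟨t, ht⟩
    let T : (Fin n → C.carrier) →+ C.carrier :=
      ⟨⟨t.eval C, Term.eval_const hid t 0⟩, eval_add hadd t⟩
    let c : Fin n → scalarRing p hp := fun i => ⟨T.comp (AddMonoidHom.single (fun _ : Fin n => C.carrier) i),
      t.subst (fun j => if j = i then .var 1 else .var 0), fun y => by
        rw [Term.eval_subst]
        change _ = t.eval C (Pi.single i y)
        congr 1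
        funext j
        by_cases hj : j = i
        · subst hj; simp
        · simp [hj]⟩
    have hsum : ∀ x, T x = ∑ i, c i • x i := fun x => by
      conv_lhs => rw [← Finset.univ_sum_single x, map_sum]
      rfl
    refine ⟨c, ?_, fun x => (ht x).symm.trans (hsum x)⟩
    ext y
    have h₁ : T (fun _ => y) = y := Term.eval_const hid t y
    rw [hsum, ← Finset.sum_smul] at h₁
    exact h₁
  · rintro ⟨c, hc, hg⟩
    have hn : Nonempty (Fin n) := by
      by_contra hempty
      rw [not_nonempty_iff] at hempty
      rw [Finset.univ_eq_empty, Finset.sum_empty] at hc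
      obtain ⟨x, y, hxy⟩ := exists_pair_ne C.carrier
      apply hxy
      rw [← one_smul (scalarRing p hp) x, ← one_smul (scalarRing p hp) y, ← hc, zero_smul,
        zero_smul]
    obtain ⟨i₀⟩ := hn
    choose f hf using fun i => (c i).2
    have key : ∀ s : Finset (Fin n), ∃ t : Term σ n, ∀ x : Fin n → C.carrier,
        t.eval C x = x i₀ + ∑ i ∈ s, c i • (x i - x i₀) := by
      intro s
      induction s using Finset.induction_on with
      | empty => exact ⟨.var i₀, fun x => by simp⟩
      | insert i s hi ih =>
        obtain ⟨t, ht⟩ := ih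
        refine ⟨p.comp₃ t (.var i₀) ((f i).comp₂ (.var i₀) (.var i)), fun x => ?_⟩
        have : (f i).eval C ![0, x i - x i₀] = c i • (x i - x i₀) := hf i _
        rw [Term.eval_comp₃, hp, Term.eval_comp₂, eval_eq_add_of_add hid hadd]
        simp only [Term.eval_var, ht, this]
        rw [Finset.sum_insert hi]
        abel
    obtain ⟨t, ht⟩ := key Finset.univ
    refine ⟨t, fun x => ?_⟩
    rw [ht, hg]
    simp only [smul_sub, Finset.sum_sub_distrib]
    rw [← Finset.sum_smul, hc, one_smul]
    abel

end Affine

theorem CentralMaltsev.eval_comm {p : Term σ 3}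
    (hc : ∀ (f : σ.ops) (x y z : Fin (σ.arity f) → C.carrier),
      p.eval C ![C.interp f x, C.interp f y, C.interp f z] =
        C.interp f fun j => p.eval C ![x j, y j, z j]) {n : ℕ} (t : Term σ n)
    (x y z : Fin n → C.carrier) :
    p.eval C ![t.eval C x, t.eval C y, t.eval C z] =
      t.eval C fun j => p.eval C ![x j, y j, z j] := by
  induction t with
  | var i => rfl
  | app f ts ih => simp only [Term.eval, ← ih]; exact hc f _ _ _

theorem CentralMaltsev.isAffineAlgebra [Finite C.carrier] [Nontrivial C.carrier]
    (hid : C.Idempotent) (h : CentralMaltsev C) : IsAffineAlgebra C := by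
  obtain ⟨p, hp, hc⟩ := h
  obtain ⟨o⟩ : Nonempty C.carrier := inferInstance
  let m : C.carrier → C.carrier → C.carrier → C.carrier := fun x y z => p.eval C ![x, y, z]
  have hl : ∀ x y, m x y y = x := fun x y => (hp x y).1
  have hr : ∀ x y, m y y x = x := fun x y => (hp x y).2
  have ent : ∀ a b c d e f g h i, m (m a b c) (m d e f) (m g h i) =
      m (m a d g) (m b e h) (m c f i) := fun a b c d e f g h i => by
    refine (CentralMaltsev.eval_comm hc p ![a, b, c] ![d, e, f] ![g, h, i]).trans ?_
    exact p.eval_congr₃ rfl rfl rfl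
  have hcomm : ∀ x y, m x o y = m y o x := fun x y => by
    have := ent o o x o o o y o o
    simpa only [hl, hr] using this
  have hassoc : ∀ x y z, m (m x o y) o z = m x o (m y o z) := fun x y z => by
    have := ent x o y o o o o o z
    simpa only [hl, hr] using this
  have hneg : ∀ x, m (m o x o) o x = o := fun x => by
    have := ent o x o o o o o o x
    simpa only [hl, hr] using this
  let _ : Zero C.carrier := ⟨o⟩
  let _ : Add C.carrier := ⟨fun x y => m x o y⟩
  let _ : Neg C.carrier := ⟨fun x => m o x o⟩
  let _ : AddCommGroup C.carrier :=
    { nsmul := nsmulRec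
      zsmul := zsmulRec
      add_assoc := hassoc
      zero_add := fun x => hr x o
      add_zero := fun x => hl x o
      neg_add_cancel := hneg
      add_comm := hcomm }
  have hm : ∀ x y z, m x y z = x - y + z := fun x y z => by
    rw [sub_eq_add_neg]
    change m x y z = m (m x o (m o y o)) o z
    have h₁ : m x o (m o y o) = m x y o := by
      have := ent x o o o o o o y o
      simpa only [hl, hr] using this
    have h₂ : m (m x y o) o z = m x y z := by
      have := ent x y o o o o o o z
      simpa only [hl, hr] using this
    rw [h₁, h₂]
  refine isAffineAlgebra_of_add hid p hm fun f x y => ?_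
  have := hc f x (fun _ => o) y
  rw [hid] at this
  exact this.symm

end UAlgebra


namespace UAlgebra

variable {σ : Signature} {X Y Z Q : UAlgebra σ}

/-! ### Generating splits -/

/-- `U` is a proper nonempty subuniverse of `Q`, and `Q` is generated by any two elements
separated by `U`. -/
structure IsGeneratingSplit (Q : UAlgebra σ) (U : Set Q.carrier) : Prop where
  isClosed : Q.IsClosed U
  nonempty : U.Nonempty
  exists_notMem : ∃ a, a ∉ U
  mem_closureSet : ∀ c ∈ U, ∀ a, a ∉ U → ∀ b, b ∈ Q.ClosureSet {c, a}

theorem IsGeneratingSplit.mem_of_isClosed {U V : Set Q.carrier} (hU : IsGeneratingSplit Q U)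
    (hV : Q.IsClosed V) {c a : Q.carrier} (hc : c ∈ U) (ha : a ∉ U) (hcV : c ∈ V) (haV : a ∈ V)
    (b : Q.carrier) : b ∈ V :=
  closureSet_pair_subset hV hcV haV (hU.mem_closureSet c hc a ha b)

theorem isHom_mk_left (hX : X.Idempotent) (x : X.carrier) :
    Q.IsHom (X.prod Q) fun q => (x, q) := fun f _ => Prod.ext (hX f x).symm rfl

theorem isHom_mk_right (hX : X.Idempotent) (x : X.carrier) :
    Q.IsHom (Q.prod X) fun q => (q, x) := fun f _ => Prod.ext rfl (hX f x).symm

theorem isHom_mk {φ : Q.carrier → X.carrier} {ψ : Q.carrier → Y.carrier} (hφ : Q.IsHom X φ)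
    (hψ : Q.IsHom Y ψ) : Q.IsHom (X.prod Y) fun q => (φ q, ψ q) := fun f q =>
  Prod.ext (hφ f q) (hψ f q)

/-- The transitive closure of a reflexive symmetric compatible relation is a congruence. -/
def Congruence.ofTolerance (T : Q.carrier → Q.carrier → Prop) (hr : ∀ x, T x x)
    (hs : ∀ x y, T x y → T y x)
    (hc : ∀ (f : σ.ops) (x y : Fin (σ.arity f) → Q.carrier), (∀ j, T (x j) (y j)) →
      T (Q.interp f x) (Q.interp f y)) : Congruence Q where
  rel := Relation.ReflTransGen T
  refl _ := .refl
  symm h := by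
    have : Std.Symm T := ⟨fun x y => hs x y⟩
    exact Std.Symm.symm _ _ h
  trans h h' := h.trans h'
  compat f x y h := by
    classical
    have step : ∀ (w : Fin (σ.arity f) → Q.carrier) (j) (v), Relation.ReflTransGen T (w j) v →
        Relation.ReflTransGen T (Q.interp f w) (Q.interp f (Function.update w j v)) := by
      intro w j v hv
      induction hv with
      | refl => rw [Function.update_eq_self]
      | tail _ hbc ih =>
        refine ih.tail (hc f _ _ fun i => ?_)
        by_cases hi : i = j
        · subst hi; simpa using hbc
        · simpa [hi] using hr _
    have key : ∀ s : Finset (Fin (σ.arity f)), Relation.ReflTransGen T (Q.interp f x)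
        (Q.interp f fun j => if j ∈ s then y j else x j) := by
      intro s
      induction s using Finset.induction_on with
      | empty => simpa using Relation.ReflTransGen.refl
      | insert j s hj ih =>
        have := ih.trans (step _ j (y j) (by simpa [hj] using h j))
        convert this using 2
        funext i
        by_cases hi : i = j
        · subst hi; simp
        · simp [hi]
    simpa using key Finset.univ

theorem exists_crossing (hQ : Q.IsSimple) {U : Set Q.carrier} (hU : U.Nonempty)
    (hU' : ∃ a, a ∉ U) (T : Q.carrier → Q.carrier → Prop) (hr : ∀ x, T x x)
    (hs : ∀ x y, T x y → T y x)
    (hc : ∀ (f : σ.ops) (x y : Fin (σ.arity f) → Q.carrier), (∀ j, T (x j) (y j)) →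
      T (Q.interp f x) (Q.interp f y)) {b b' : Q.carrier} (hne : b ≠ b') (hT : T b b') :
    ∃ u ∈ U, ∃ o, o ∉ U ∧ T u o := by
  rcases hQ (Congruence.ofTolerance T hr hs hc) with h | h
  · exact absurd ((h b b').1 (.single hT)) hne
  obtain ⟨u, hu⟩ := hU
  obtain ⟨a, ha⟩ := hU'
  have hua : Relation.ReflTransGen T u a := h u a
  by_contra hcon
  push Not at hcon
  have : ∀ v, Relation.ReflTransGen T u v → v ∈ U := fun v hv => by
    induction hv with
    | refl => exact hu
    | tail _ hbc ih =>
      by_contra hv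
      exact hcon _ ih _ hv hbc
  exact ha (this a hua)

/-- A subuniverse of `Z × Q`, with `Q` simple, which has a fiber with two elements, has a full
fiber. -/
theorem IsGeneratingSplit.exists_full_fiber (hZ : Z.Idempotent) (hQ : Q.IsSimple)
    {U : Set Q.carrier} (hU : IsGeneratingSplit Q U) {L : Set (Z.prod Q).carrier}
    (hL : (Z.prod Q).IsClosed L) {z₁ z₂ z : Z.carrier} {c a b b' : Q.carrier} (hc : c ∈ U)
    (ha : a ∉ U) (hcL : (z₁, c) ∈ L) (haL : (z₂, a) ∈ L) (hne : b ≠ b') (hb : (z, b) ∈ L)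
    (hb' : (z, b') ∈ L) : ∃ z, ∀ q, (z, q) ∈ L := by
  have hsurj : ∀ q, ∃ z, (z, q) ∈ L := fun q => by
    obtain ⟨⟨z, _⟩, hz, rfl⟩ := hU.mem_of_isClosed (hL.image isHom_snd) hc ha
      ⟨_, hcL, rfl⟩ ⟨_, haL, rfl⟩ q
    exact ⟨z, hz⟩
  obtain ⟨u, hu, o, ho, w, hwu, hwo⟩ := exists_crossing hQ hU.nonempty hU.exists_notMem
    (fun q q' => ∃ z, (z, q) ∈ L ∧ (z, q') ∈ L) (fun q => (hsurj q).imp fun _ h => ⟨h, h⟩)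
    (fun q q' ⟨z, h, h'⟩ => ⟨z, h', h⟩)
    (fun f x y h => by
      choose w hwx hwy using h
      exact ⟨Z.interp f w, hL f (fun j => (w j, x j)) hwx, hL f (fun j => (w j, y j)) hwy⟩)
    hne ⟨z, hb, hb'⟩
  exact ⟨w, hU.mem_of_isClosed (hL.preimage (isHom_mk_left hZ w)) hu ho hwu hwo⟩

/-! ### Near unanimity -/

/-- The subuniverse of `X × Y × Q` used to express that the value `a ∉ U` in the last coordinate
can be attained together with `x` and `x'`. -/
def forkClosure (U : Set Q.carrier) (x y : X.carrier) (x' y' : Y.carrier) (a : Q.carrier) :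
    Set ((X.prod Y).prod Q).carrier :=
  ((X.prod Y).prod Q).ClosureSet
    ({w | w.1 = (x, x') ∧ w.2 ∈ U} ∪ {((y, x'), a), ((x, y'), a)})

/-- Values outside of `U` can be attained together with two prescribed values. -/
def NearUnanimous (X Y Q : UAlgebra σ) (U : Set Q.carrier) : Prop :=
  ∀ (x y : X.carrier) (x' y' : Y.carrier) (a : Q.carrier), a ∉ U →
    ((x, x'), a) ∈ forkClosure U x y x' y' a

theorem mem_forkClosure_of_mem {U : Set Q.carrier} {x y : X.carrier} {x' y' : Y.carrier}
    {a u : Q.carrier} (hu : u ∈ U) : ((x, x'), u) ∈ forkClosure U x y x' y' a :=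
  subset_closureSet _ (Or.inl ⟨rfl, hu⟩)

theorem left_mem_forkClosure {U : Set Q.carrier} {x y : X.carrier} {x' y' : Y.carrier}
    {a : Q.carrier} : ((y, x'), a) ∈ forkClosure U x y x' y' a :=
  subset_closureSet _ (Or.inr (Or.inl rfl))

theorem right_mem_forkClosure {U : Set Q.carrier} {x y : X.carrier} {x' y' : Y.carrier}
    {a : Q.carrier} : ((x, y'), a) ∈ forkClosure U x y x' y' a :=
  subset_closureSet _ (Or.inr (Or.inr rfl))

theorem mem_forkClosure_of_term {U : Set Q.carrier} {x y : X.carrier} {x' y' : Y.carrier}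
    {a c : Q.carrier} (hc : c ∈ U) (s : Term σ 3) (h₁ : s.eval X ![y, x, x] = x)
    (h₂ : s.eval Y ![x', y', x'] = x') (h₃ : s.eval Q ![a, a, c] = a) :
    ((x, x'), a) ∈ forkClosure U x y x' y' a := by
  have := (isClosed_closureSet (A := (X.prod Y).prod Q) _).eval_mem₃ s
    (left_mem_forkClosure (U := U) (x := x) (y := y) (x' := x') (y' := y') (a := a))
    right_mem_forkClosure (mem_forkClosure_of_mem hc)
  have e : s.eval ((X.prod Y).prod Q) ![((y, x'), a), ((x, y'), a), ((x, x'), c)] =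
      ((x, x'), a) :=
    Prod.ext ((isHom_fst.eval₃ s _ _ _).trans (Prod.ext ((isHom_fst.eval₃ s _ _ _).trans h₁)
      ((isHom_snd.eval₃ s _ _ _).trans h₂))) ((isHom_snd.eval₃ s _ _ _).trans h₃)
  exact e ▸ this

/-- Near unanimity lifts along surjective homomorphisms. -/
theorem NearUnanimous.lift {B : UAlgebra σ} {U : Set Q.carrier} (hX : X.Idempotent)
    (hY : Y.Idempotent) (h : NearUnanimous X Y Q U) {φ : B.carrier → Q.carrier}
    (hφ : B.IsHom Q φ) (hs : Function.Surjective φ) (hU : IsGeneratingSplit B (φ ⁻¹' U)) :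
    NearUnanimous X Y B (φ ⁻¹' U) := by
  intro x y x' y' a ha
  obtain ⟨u, hu⟩ := hU.nonempty
  obtain ⟨w, hw, hwq⟩ : ((x, x'), φ a) ∈
      (fun w : ((X.prod Y).prod B).carrier => (w.1, φ w.2)) '' forkClosure (φ ⁻¹' U) x y x' y' a := by
    refine closureSet_subset (A := (X.prod Y).prod Q) ?_ ?_ (h x y x' y' (φ a) ha)
    · exact (isClosed_closureSet _).image (B := (X.prod Y).prod Q)
        fun f w => Prod.ext rfl (hφ f _)
    · rintro ⟨w₁, w₂⟩ (⟨h₁, h₂⟩ | h₁ | h₁)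
      · obtain ⟨b, rfl⟩ := hs w₂
        obtain rfl : w₁ = _ := h₁
        exact ⟨((x, x'), b), mem_forkClosure_of_mem h₂, rfl⟩
      · exact ⟨_, left_mem_forkClosure, h₁.symm⟩
      · exact ⟨_, right_mem_forkClosure, h₁.symm⟩
  obtain ⟨w₁, w₂⟩ := w
  obtain ⟨rfl, h₂⟩ : w₁ = (x, x') ∧ φ w₂ = φ a := Prod.ext_iff.1 hwq
  exact hU.mem_of_isClosed ((isClosed_closureSet _).preimage
    (isHom_mk_left (hX.prod hY) (x, x'))) hu (a := w₂) (fun h => ha ((congrArg (· ∈ U) h₂).mp h))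
    (mem_forkClosure_of_mem hu) hw a

end UAlgebra


namespace UAlgebra

variable {σ : Signature} {κ : Type} {E : κ → UAlgebra σ} {X Y Q : UAlgebra σ}

/-- The subuniverse of `Q × F` generated by the pairs `(u, gx)` with `u ∈ U` and all pairs
`(q, gy)`. -/
def freeClosure (E : κ → UAlgebra σ) (U : Set Q.carrier) :
    Set (Q.prod (freePower E)).carrier :=
  (Q.prod (freePower E)).ClosureSet ({w | w.1 ∈ U ∧ w.2 = gx E} ∪ {w | w.2 = gy E})

theorem isClosed_freeClosure (U : Set Q.carrier) :
    (Q.prod (freePower E)).IsClosed (freeClosure E U) := isClosed_closureSet _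

theorem mk_gx_mem_freeClosure {U : Set Q.carrier} {u : Q.carrier} (hu : u ∈ U) :
    (u, gx E) ∈ freeClosure E U := subset_closureSet _ (Or.inl ⟨hu, rfl⟩)

theorem mk_gy_mem_freeClosure {U : Set Q.carrier} (q : Q.carrier) :
    (q, gy E) ∈ freeClosure E U := subset_closureSet _ (Or.inr rfl)

/-- The fibers of the free closure over elements outside of `U` are full, if the fiber meets
`U`. -/
theorem fiber_freeClosure (hid : ∀ k, (E k).Idempotent) {U : Set Q.carrier}
    (hU : IsGeneratingSplit Q U) {z : (freePower E).carrier} {u b : Q.carrier} (hu : u ∈ U)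
    (hb : b ∉ U) (hu' : (u, z) ∈ freeClosure E U) (hb' : (b, z) ∈ freeClosure E U)
    (q : Q.carrier) : (q, z) ∈ freeClosure E U :=
  hU.mem_of_isClosed ((isClosed_freeClosure U).preimage
    (isHom_mk_right (idempotent_freePower hid) z)) hu hb hu' hb' q

theorem nearUnanimous_of_nontrivial (hid : ∀ k, (E k).Idempotent) (hQ : Q.IsSimple)
    {U : Set Q.carrier} (hU : IsGeneratingSplit Q U) {u u' : Q.carrier} (hu : u ∈ U)
    (hu' : u' ∈ U) (hne : u ≠ u') {b : Q.carrier} (hb : b ∉ U)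
    (hb' : (b, gx E) ∈ freeClosure E U) (k₁ k₂ : κ) : NearUnanimous (E k₁) (E k₂) Q U := by
  intro x y x' y' a ha
  have hcl : (((E k₁).prod (E k₂)).prod Q).IsClosed (forkClosure U x y x' y' a) :=
    isClosed_closureSet _
  obtain ⟨⟨z, z'⟩, hz⟩ := hU.exists_full_fiber ((hid k₁).prod (hid k₂)) hQ hcl
    (z₁ := (x, x')) (z₂ := (y, x')) (z := (x, x')) hu ha (mem_forkClosure_of_mem hu)
    left_mem_forkClosure hne (mem_forkClosure_of_mem hu) (mem_forkClosure_of_mem hu')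
  let φ : (Q.prod (freePower E)).carrier → (((E k₁).prod (E k₂)).prod Q).carrier := fun w =>
    ((w.2 ⟨k₁, x, z⟩, w.2 ⟨k₂, x', z'⟩), w.1)
  have hφ : (Q.prod (freePower E)).IsHom _ φ := fun _ _ => rfl
  have hsub : freeClosure E U ⊆ φ ⁻¹' forkClosure U x y x' y' a := by
    refine closureSet_subset (hcl.preimage hφ) ?_
    rintro ⟨w₁, w₂⟩ (⟨h₁, h₂⟩ | h₂)
    · obtain rfl : w₂ = gx E := h₂
      exact mem_forkClosure_of_mem h₁
    · obtain rfl : w₂ = gy E := h₂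
      exact hz w₁
  exact hsub (fiber_freeClosure hid hU hu hb (mk_gx_mem_freeClosure hu) hb' a)

theorem exists_isLeftMaltsev_of_singleton (hid : ∀ k, (E k).Idempotent)
    {c : Q.carrier} (hU : IsGeneratingSplit Q {c}) {b : Q.carrier} (hb : b ∉ ({c} : Set Q.carrier))
    (hb' : (b, gx E) ∈ freeClosure E {c}) (q : Q.carrier) :
    ∃ p, IsLeftMaltsev E p ∧ p.eval Q ![c, c, q] = q := by
  by_cases hq : q = c
  · exact ⟨.var 0, fun _ _ _ => rfl, hq.symm⟩
  have hsub : freeClosure E {c} ⊆ (Q.prod (freePower E)).ClosureSet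
      {(c, gx E), (c, gy E), (q, gy E)} := by
    refine closureSet_subset (isClosed_closureSet _) ?_
    rintro ⟨w₁, w₂⟩ (⟨h₁, h₂⟩ | h₂)
    · obtain rfl : w₂ = gx E := h₂
      obtain rfl : w₁ = c := h₁
      exact subset_closureSet _ (Or.inl rfl)
    · obtain rfl : w₂ = gy E := h₂
      exact hU.mem_of_isClosed ((isClosed_closureSet _).preimage
        (isHom_mk_right (idempotent_freePower hid) (gy E))) rfl (a := q) hq
        (subset_closureSet _ (Or.inr (Or.inl rfl)))
        (subset_closureSet _ (Or.inr (Or.inr rfl))) w₁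
  obtain ⟨p, hp⟩ := exists_eval_of_mem_triple (A := Q.prod (freePower E))
    (hsub (fiber_freeClosure hid hU rfl hb (mk_gx_mem_freeClosure rfl) hb' q))
  refine ⟨p, isLeftMaltsev_of_eval_gx ?_, ?_⟩
  · exact (isHom_snd.eval₃ p _ _ _).symm.trans (congrArg Prod.snd hp)
  · exact (isHom_fst.eval₃ p _ _ _).symm.trans (congrArg Prod.fst hp)

/-- The ternary relation generated by `(a, c, a)`, `(c, a, a)` and `(c, c, c)`. -/
def sumClosure (c a : Q.carrier) : Set ((Q.prod Q).prod Q).carrier :=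
  ((Q.prod Q).prod Q).ClosureSet {((a, c), a), ((c, a), a), ((c, c), c)}

theorem isClosed_sumClosure (c a : Q.carrier) :
    ((Q.prod Q).prod Q).IsClosed (sumClosure c a) := isClosed_closureSet _

theorem mem_sumClosure₁ (c a : Q.carrier) : ((a, c), a) ∈ sumClosure c a :=
  subset_closureSet _ (Or.inl rfl)

theorem mem_sumClosure₂ (c a : Q.carrier) : ((c, a), a) ∈ sumClosure c a :=
  subset_closureSet _ (Or.inr (Or.inl rfl))

theorem mem_sumClosure₃ (c a : Q.carrier) : ((c, c), c) ∈ sumClosure c a :=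
  subset_closureSet _ (Or.inr (Or.inr rfl))

theorem eval_triple (t : Term σ 3) (u v w : Q.carrier) (u' v' w' : X.carrier)
    (u'' v'' w'' : Y.carrier) :
    t.eval ((Q.prod X).prod Y) ![((u, u'), u''), ((v, v'), v''), ((w, w'), w'')] =
      ((t.eval Q ![u, v, w], t.eval X ![u', v', w']), t.eval Y ![u'', v'', w'']) :=
  Prod.ext ((isHom_fst.eval₃ t _ _ _).trans (Prod.ext (isHom_fst.eval₃ t _ _ _)
    (isHom_snd.eval₃ t _ _ _))) (isHom_snd.eval₃ t _ _ _)

theorem IsClosed.triple_mem {V : Set ((Q.prod X).prod Y).carrier}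
    (hV : ((Q.prod X).prod Y).IsClosed V) (t : Term σ 3) {u v w : Q.carrier}
    {u' v' w' : X.carrier} {u'' v'' w'' : Y.carrier} (h₁ : ((u, u'), u'') ∈ V)
    (h₂ : ((v, v'), v'') ∈ V) (h₃ : ((w, w'), w'') ∈ V) :
    ((t.eval Q ![u, v, w], t.eval X ![u', v', w']), t.eval Y ![u'', v'', w'']) ∈ V :=
  (congrArg (· ∈ V) (eval_triple t u v w u' v' w' u'' v'' w'')).mp (hV.eval_mem₃ t h₁ h₂ h₃)

theorem exists_term_of_not_graph (hsat : Sat E Q) (hid : ∀ k, (E k).Idempotent)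
    (hQid : Q.Idempotent) (hQ : Q.IsSimple)
    {c : Q.carrier} (hU : IsGeneratingSplit Q {c}) {a : Q.carrier} (ha : a ≠ c)
    {p : Term σ 3} (hp : IsLeftMaltsev E p) (hpa : p.eval Q ![c, c, a] = a)
    {z : (Q.prod Q).carrier} {b b' : Q.carrier} (hb : (z, b) ∈ sumClosure c a)
    (hb' : (z, b') ∈ sumClosure c a) (hne : b ≠ b') :
    ∃ s : Term σ 3, (∀ k (x y : (E k).carrier), s.eval (E k) ![y, x, x] = x ∧
      s.eval (E k) ![x, y, x] = x) ∧ s.eval Q ![a, a, c] = a := by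
  obtain ⟨⟨z, z'⟩, hz⟩ := hU.exists_full_fiber (hQid.prod hQid) hQ (isClosed_sumClosure c a)
    rfl (a := a) ha (mem_sumClosure₃ c a) (mem_sumClosure₁ c a) hne hb hb'
  have hmem := (isClosed_sumClosure c a).triple_mem p (mem_sumClosure₃ c a) (hz c) (hz a)
  rw [hp.eval_sat hsat, hp.eval_sat hsat, hpa] at hmem
  obtain ⟨q, hq⟩ := exists_eval_of_mem_triple (A := (Q.prod Q).prod Q) hmem
  obtain ⟨hq', hq₃⟩ := Prod.ext_iff.1 ((eval_triple q _ _ _ _ _ _ _ _ _).symm.trans hq)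
  obtain ⟨hq₁, hq₂⟩ := Prod.ext_iff.1 hq'
  have hq₁ : q.eval Q ![a, c, c] = c := hq₁
  have hq₂ : q.eval Q ![c, a, c] = c := hq₂
  have hq₃ : q.eval Q ![a, a, c] = a := hq₃
  let u : Term σ 3 := q.comp₃ (.var 0) (.var 2) (.var 2)
  let v : Term σ 3 := q.comp₃ (.var 2) (.var 1) (.var 2)
  refine ⟨p.comp₃ (.var 2) (p.comp₃ u (.var 2) v) (p.comp₃ u u q), fun k x y => ⟨?_, ?_⟩, ?_⟩
  · simp [u, v, Term.eval_const₃ (hid k), hp k]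
  · simp [u, v, Term.eval_const₃ (hid k), hp k]
  · simp [u, v, hq₁, hq₂, hq₃, hpa, Term.eval_const₃ hQid]

theorem centralMaltsev_of_graph [Finite Q.carrier] (hsat : Sat E Q)
    (hQid : Q.Idempotent) (hQ : Q.IsSimple)
    {c : Q.carrier} (hU : IsGeneratingSplit Q {c}) {a : Q.carrier} (ha : a ≠ c)
    (hp : ∀ q : Q.carrier, ∃ p, IsLeftMaltsev E p ∧ p.eval Q ![c, c, q] = q)
    (hgraph : ∀ z b b', (z, b) ∈ sumClosure c a → (z, b') ∈ sumClosure c a → b = b') :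
    CentralMaltsev Q := by
  have hid : Q.IsHom Q fun q => q := fun _ _ => rfl
  have hcl := isClosed_sumClosure c a
  have hconst : ∀ b : Q.carrier, Q.IsHom Q fun _ => b := fun b f _ => (hQid f b).symm
  have hl : ∀ q, ((q, c), q) ∈ sumClosure c a := hU.mem_of_isClosed
    (hcl.preimage (isHom_mk (isHom_mk hid (hconst c)) hid)) rfl (a := a) ha
    (mem_sumClosure₃ c a) (mem_sumClosure₁ c a)
  have hr : ∀ q, ((c, q), q) ∈ sumClosure c a := hU.mem_of_isClosed
    (hcl.preimage (isHom_mk (isHom_mk (hconst c) hid) hid)) rfl (a := a) ha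
    (mem_sumClosure₃ c a) (mem_sumClosure₂ c a)
  have htotal : ∀ b b', ∃ d, ((b, b'), d) ∈ sumClosure c a := fun b b' => by
    obtain ⟨p, hp, hpb⟩ := hp b'
    have := hcl.triple_mem p (hl b) (mem_sumClosure₃ c a) (hr b')
    rw [hp.eval_sat hsat, hpb] at this
    exact ⟨_, this⟩
  choose φ hφ using htotal
  have hφl : ∀ q, φ q c = q := fun q => hgraph _ _ _ (hφ q c) (hl q)
  have hφr : ∀ q, φ c q = q := fun q => hgraph _ _ _ (hφ c q) (hr q)
  have hom : (Q.prod Q).IsHom Q fun w => φ w.1 w.2 := fun f w =>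
    hgraph _ _ _ (hφ _ _) (hcl f (fun j => (w j, φ (w j).1 (w j).2)) fun j => hφ _ _)
  have hom₃ : ∀ (t : Term σ 3) (u v w u' v' w' : Q.carrier),
      t.eval Q ![φ u u', φ v v', φ w w'] = φ (t.eval Q ![u, v, w]) (t.eval Q ![u', v', w']) :=
    fun t u v w u' v' w' => by
      exact (hom.eval₃ t (u, u') (v, v') (w, w')).symm.trans
        (congrArg₂ φ (isHom_fst.eval₃ t _ _ _) (isHom_snd.eval₃ t _ _ _))
  have hinj : ∀ e, Function.Injective (φ e) := by
    intro e w w' hww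
    by_contra hne
    obtain ⟨u, rfl, o, ho, g, hg⟩ := exists_crossing hQ hU.nonempty hU.exists_notMem
      (fun w w' => ∃ e, φ e w = φ e w') (fun w => ⟨c, rfl⟩) (fun w w' ⟨e, h⟩ => ⟨e, h.symm⟩)
      (fun f x y h => by
        choose e he using h
        refine ⟨Q.interp f e, ?_⟩
        refine (hom f fun j => (e j, x j)).trans (Eq.trans ?_ (hom f fun j => (e j, y j)).symm)
        simp only [he]) hne ⟨e, hww⟩
    obtain ⟨p, hp, hpo⟩ := hp o
    have := hom₃ p u g g u u o
    rw [hφl u, hp.eval_sat hsat, hg, hp.eval_sat hsat, hpo, hφr] at this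
    exact ho this.symm
  have hsurj : ∀ e, Function.Surjective (φ e) := fun e => Finite.injective_iff_surjective.1 (hinj e)
  obtain ⟨p, hpM, hpp⟩ := exists_isLeftMaltsev_forall (E := E) hQid fun e b => by
    obtain ⟨w, rfl⟩ := hsurj e b
    obtain ⟨p, hpM, hpw⟩ := hp w
    refine ⟨p, hpM, ?_⟩
    have := hom₃ p e e e c c w
    rwa [hφl, Term.eval_const₃ hQid, hpw] at this
  have hform : ∀ x y s, p.eval Q ![x, y, φ y s] = φ x s := fun x y s => by
    have := hom₃ p x y y c c s
    rwa [hφl, hφl, hpM.eval_sat hsat, hpp] at this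
  refine ⟨p, fun x y => ⟨hpM.eval_sat hsat x y, hpp y x⟩, fun f x y z => ?_⟩
  choose s hs using fun j => hsurj (y j) (z j)
  obtain rfl : (fun j => φ (y j) (s j)) = z := funext hs
  simp only [hform]
  rw [← hom f fun j => (y j, s j), ← hom f fun j => (x j, s j)]
  exact hform _ _ _

/-- The case in which the free closure contains a pair `(b, gx)` with `b ∉ U`. -/
theorem centralMaltsev_or_nearUnanimous_of_mem [Finite Q.carrier] (hid : ∀ k, (E k).Idempotent)
    (hsat : Sat E Q) (hQid : Q.Idempotent) (hQ : Q.IsSimple)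
    {U : Set Q.carrier} (hU : IsGeneratingSplit Q U) {b : Q.carrier} (hb : b ∉ U)
    (hb' : (b, gx E) ∈ freeClosure E U) :
    CentralMaltsev Q ∨ ∀ k₁ k₂, NearUnanimous (E k₁) (E k₂) Q U := by
  by_cases hne : ∃ u ∈ U, ∃ u' ∈ U, u ≠ u'
  · obtain ⟨u, hu, u', hu', hne⟩ := hne
    exact Or.inr (nearUnanimous_of_nontrivial hid hQ hU hu hu' hne hb hb')
  push Not at hne
  obtain ⟨c, hc⟩ := hU.nonempty
  obtain rfl : U = {c} := Set.eq_singleton_iff_unique_mem.2 ⟨hc, fun x hx => hne x hx c hc⟩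
  have hp := exists_isLeftMaltsev_of_singleton hid hU hb hb'
  by_cases hgraph : ∃ a, a ≠ c ∧
      ∀ z b b', (z, b) ∈ sumClosure c a → (z, b') ∈ sumClosure c a → b = b'
  · obtain ⟨a, ha, hgraph⟩ := hgraph
    exact Or.inl (centralMaltsev_of_graph hsat hQid hQ hU ha hp hgraph)
  refine Or.inr fun k₁ k₂ x y x' y' a ha => ?_
  push Not at hgraph
  obtain ⟨z, d, d', hd, hd', hdd⟩ := hgraph a ha
  obtain ⟨p, hpM, hpa⟩ := hp a
  obtain ⟨s, hs, hsa⟩ := exists_term_of_not_graph hsat hid hQid hQ hU ha hpM hpa hd hd' hdd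
  exact mem_forkClosure_of_term hc s (hs k₁ x y).1 (hs k₂ x' y').2 hsa

end UAlgebra


namespace UAlgebra

variable {σ : Signature} {κ : Type} {E : κ → UAlgebra σ} {X Y Q : UAlgebra σ}

/-- The elements of the free algebra having a neighbour outside of `U`. -/
def outerPart (E : κ → UAlgebra σ) (U : Set Q.carrier) : Set (freePower E).carrier :=
  {z | ∃ b, b ∉ U ∧ (b, z) ∈ freeClosure E U}

/-- The free algebra on two generators. -/
def freeTwo (E : κ → UAlgebra σ) : Set (freePower E).carrier :=
  (freePower E).ClosureSet {gx E, gy E}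

theorem outerPart_subset_freeTwo (U : Set Q.carrier) : outerPart E U ⊆ freeTwo E := by
  rintro z ⟨b, -, hb⟩
  refine closureSet_subset (V := Prod.snd ⁻¹' freeTwo E)
    (IsClosed.preimage (isClosed_closureSet _) isHom_snd) ?_ hb
  rintro ⟨w₁, w₂⟩ (⟨-, h⟩ | h)
  · obtain rfl : w₂ = gx E := h
    exact left_mem_closureSet _ _
  · obtain rfl : w₂ = gy E := h
    exact right_mem_closureSet _ _

theorem mk_mem_freeClosure_of_mem (hQid : Q.Idempotent) {U : Set Q.carrier} {u : Q.carrier}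
    (hu : u ∈ U) {z : (freePower E).carrier} (hz : z ∈ freeTwo E) : (u, z) ∈ freeClosure E U :=
  closureSet_pair_subset ((isClosed_freeClosure U).preimage (isHom_mk_left hQid u))
    (mk_gx_mem_freeClosure hu) (mk_gy_mem_freeClosure u) hz

theorem mk_mem_freeClosure_of_outer (hid : ∀ k, (E k).Idempotent) (hQid : Q.Idempotent)
    {U : Set Q.carrier} (hU : IsGeneratingSplit Q U) {z : (freePower E).carrier}
    (hz : z ∈ outerPart E U) (q : Q.carrier) : (q, z) ∈ freeClosure E U := by
  obtain ⟨u, hu⟩ := hU.nonempty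
  have hzF := outerPart_subset_freeTwo U hz
  obtain ⟨b, hb, hbz⟩ := hz
  exact fiber_freeClosure hid hU hu hb (mk_mem_freeClosure_of_mem hQid hu hzF) hbz q

/-- If `t` can leave `U` with the arguments in `J` taken from `U`, then `t` preserves the outer
part in the remaining arguments. -/
theorem eval_mem_outerPart (hid : ∀ k, (E k).Idempotent) (hQid : Q.Idempotent)
    {U : Set Q.carrier} (hU : IsGeneratingSplit Q U) {n : ℕ} (t : Term σ n) {J : Fin n → Prop}
    {q : Fin n → Q.carrier} (hq : ∀ j, J j → q j ∈ U) (ht : t.eval Q q ∉ U)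
    {z : Fin n → (freePower E).carrier} (hz : ∀ j, z j ∈ freeTwo E)
    (hz' : ∀ j, ¬ J j → z j ∈ outerPart E U) : t.eval (freePower E) z ∈ outerPart E U := by
  refine ⟨_, ht, ?_⟩
  have := (isClosed_freeClosure U).eval_mem t (x := fun j => (q j, z j)) fun j => by
    by_cases hj : J j
    · exact mk_mem_freeClosure_of_mem hQid (hq j hj) (hz j)
    · exact mk_mem_freeClosure_of_outer hid hQid hU (hz' j hj) (q j)
  exact (congrArg (· ∈ freeClosure E U) (eval_prod (A := Q) (B := freePower E) t _)).mp this

/-- The term absorbs `U` in its first argument. -/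
def AbsorbsLeft (U : Set Q.carrier) (f : Term σ 2) : Prop := ∀ u ∈ U, ∀ q, f.eval Q ![u, q] ∈ U

/-- The term absorbs `U` in its second argument. -/
def AbsorbsRight (U : Set Q.carrier) (f : Term σ 2) : Prop := ∀ u ∈ U, ∀ q, f.eval Q ![q, u] ∈ U

/-- The term absorbs the outer part in its second argument. -/
def OuterRight (E : κ → UAlgebra σ) (U : Set Q.carrier) (f : Term σ 2) : Prop :=
  ∀ z ∈ freeTwo E, ∀ z' ∈ outerPart E U, f.eval (freePower E) ![z, z'] ∈ outerPart E U

/-- The term absorbs the outer part in its first argument. -/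
def OuterLeft (E : κ → UAlgebra σ) (U : Set Q.carrier) (f : Term σ 2) : Prop :=
  ∀ z ∈ freeTwo E, ∀ z' ∈ outerPart E U, f.eval (freePower E) ![z', z] ∈ outerPart E U

/-- The standing assumptions of the case in which `gx` is not in the outer part. -/
structure MedianCase (E : κ → UAlgebra σ) (Q : UAlgebra σ) (U : Set Q.carrier) : Prop where
  idem : ∀ k, (E k).Idempotent
  slf : ∀ k, (E k).SLF
  finite_free : Finite (freePower E).carrier
  idem_Q : Q.Idempotent
  slf_Q : Q.SLF
  finite_Q : Finite Q.carrier
  split : IsGeneratingSplit Q U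
  gx_notMem : gx E ∉ outerPart E U

namespace MedianCase

variable {U : Set Q.carrier} (h : MedianCase E Q U)

include h

theorem not_outerLeft_and_outerRight (f : Term σ 2) (hl : OuterLeft E U f)
    (hr : OuterRight E U f) : False := by
  have := h.finite_free
  obtain ⟨a, ha⟩ := h.split.exists_notMem
  refine h.gx_notMem ((slf_freePower h.slf).mem_of_absorbs (idempotent_freePower h.idem)
    ⟨gy E, a, ha, mk_gy_mem_freeClosure a⟩ f (fun z hz => hr _ (left_mem_closureSet _ _) z hz)
    fun z hz k => ?_)
  induction k with
  | zero => exact hl _ (left_mem_closureSet _ _) z hz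
  | succ k ih =>
    rw [Function.iterate_succ_apply']
    exact hl _ (outerPart_subset_freeTwo U ih) z hz

theorem outerRight_of_not_absorbsLeft {f : Term σ 2} (hf : ¬ AbsorbsLeft U f) :
    OuterRight E U f := by
  unfold AbsorbsLeft at hf
  push Not at hf
  obtain ⟨u, hu, q, hq⟩ := hf
  refine fun z hz z' hz' => eval_mem_outerPart h.idem h.idem_Q h.split f (J := fun j => j = 0)
    (q := ![u, q]) ?_ hq ?_ ?_
  · rintro _ rfl; exact hu
  · intro j; fin_cases j
    exacts [hz, outerPart_subset_freeTwo U hz']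
  · intro j hj; fin_cases j
    exacts [absurd rfl hj, hz']

theorem outerLeft_of_not_absorbsRight {f : Term σ 2} (hf : ¬ AbsorbsRight U f) :
    OuterLeft E U f := by
  unfold AbsorbsRight at hf
  push Not at hf
  obtain ⟨u, hu, q, hq⟩ := hf
  refine fun z hz z' hz' => eval_mem_outerPart h.idem h.idem_Q h.split f (J := fun j => j = 1)
    (q := ![q, u]) ?_ hq ?_ ?_
  · rintro _ rfl; exact hu
  · intro j; fin_cases j
    exacts [outerPart_subset_freeTwo U hz', hz]
  · intro j hj; fin_cases j
    exacts [hz', absurd rfl hj]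

theorem not_absorbsLeft_and_absorbsRight (f : Term σ 2) (hl : AbsorbsLeft U f)
    (hr : AbsorbsRight U f) : False := by
  have := h.finite_Q
  obtain ⟨a, ha⟩ := h.split.exists_notMem
  refine ha (h.slf_Q.mem_of_absorbs h.idem_Q h.split.nonempty f (fun z hz => hr z hz a)
    fun z hz k => ?_)
  rw [Function.iterate_succ_apply']
  exact hl z hz _

theorem absorbsRight_of_not_absorbsLeft {f : Term σ 2} (hf : ¬ AbsorbsLeft U f) :
    AbsorbsRight U f := by
  by_contra hr
  exact h.not_outerLeft_and_outerRight f (h.outerLeft_of_not_absorbsRight hr)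
    (h.outerRight_of_not_absorbsLeft hf)

theorem not_outerRight_of_absorbsLeft {f : Term σ 2} (hf : AbsorbsLeft U f) :
    ¬ OuterRight E U f := fun hr =>
  h.not_outerLeft_and_outerRight f (h.outerLeft_of_not_absorbsRight fun hr' =>
    h.not_absorbsLeft_and_absorbsRight f hf hr') hr

theorem exists_good_pair : ∃ c ∈ U, ∃ a, a ∉ U ∧
    ∀ f : Term σ 2, AbsorbsRight U f → f.eval Q ![c, a] ∉ U := by
  classical
  have := h.finite_Q
  have := Fintype.ofFinite Q.carrier
  by_contra hcon
  push Not at hcon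
  obtain ⟨a, ha⟩ := h.split.exists_notMem
  have key : ∀ s : Finset Q.carrier, ∃ f : Term σ 2, AbsorbsRight U f ∧
      ∀ c ∈ s, c ∈ U → f.eval Q ![c, a] ∈ U := by
    intro s
    induction s using Finset.induction_on with
    | empty => exact ⟨.var 1, fun u hu q => hu, by simp⟩
    | insert c s _ ih =>
      obtain ⟨f, hf, hfs⟩ := ih
      by_cases hc : c ∈ U ∧ f.eval Q ![c, a] ∉ U
      · obtain ⟨f', hf', hfc⟩ := hcon c hc.1 _ hc.2
        refine ⟨f'.comp₂ (.var 0) f, fun u hu q => ?_, fun d hd hdU => ?_⟩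
        · rw [Term.eval_comp₂]
          exact hf' _ (hf u hu q) _
        · rw [Term.eval_comp₂]
          rcases Finset.mem_insert.1 hd with rfl | hd
          · exact hfc
          · exact hf' _ (hfs d hd hdU) _
      · refine ⟨f, hf, fun d hd hdU => ?_⟩
        rcases Finset.mem_insert.1 hd with rfl | hd
        · by_contra hcon'
          exact hc ⟨hdU, hcon'⟩
        · exact hfs d hd hdU
  obtain ⟨f, hf, hfU⟩ := key Finset.univ
  refine ha (h.slf_Q.mem_of_absorbs h.idem_Q h.split.nonempty f (fun z hz => hf z hz a)
    fun z hz k => ?_)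
  induction k with
  | zero => exact hfU z (Finset.mem_univ _) hz
  | succ k ih =>
    rw [Function.iterate_succ_apply']
    exact hf _ ih z

/-- Absorption of `U` by the composition of an operation with binary terms depends only on the
absorption by these terms. -/
theorem absorbsLeft_app_iff (f : σ.ops) (g : Fin (σ.arity f) → Term σ 2) :
    AbsorbsLeft (Q := Q) U (.app f g) ↔
      ∀ q : Fin (σ.arity f) → Q.carrier, (∀ j, AbsorbsLeft U (g j) → q j ∈ U) →
        Q.interp f q ∈ U := by
  refine ⟨fun hl => ?_, fun hq u hu q => hq _ fun j hj => hj u hu q⟩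
  by_contra hcon
  push Not at hcon
  obtain ⟨q, hq, hqU⟩ := hcon
  refine h.not_outerRight_of_absorbsLeft hl fun z hz z' hz' => ?_
  exact eval_mem_outerPart h.idem h.idem_Q h.split (.app f .var) hq hqU
    (z := fun j => (g j).eval (freePower E) ![z, z'])
    (fun j => (isClosed_closureSet _).eval_mem₂ (g j) hz (outerPart_subset_freeTwo U hz'))
    fun j hj => h.outerRight_of_not_absorbsLeft hj z hz z' hz'

theorem isClosed_compl_congr (f : σ.ops) (x y : Fin (σ.arity f) → Q.carrier)
    (hxy : ∀ j, x j ∈ U ↔ y j ∈ U) : Q.interp f x ∈ U ↔ Q.interp f y ∈ U := by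
  obtain ⟨c, hc, a, ha, hgood⟩ := h.exists_good_pair
  have hiff : ∀ g : Term σ 2, g.eval Q ![c, a] ∈ U ↔ AbsorbsLeft U g := fun g => by
    refine ⟨fun hg => ?_, fun hg => hg c hc a⟩
    by_contra hl
    exact hgood g (h.absorbsRight_of_not_absorbsLeft hl) hg
  have hterm : ∀ b, ∃ g : Term σ 2, g.eval Q ![c, a] = b := fun b =>
    exists_eval_of_mem_pair (h.split.mem_closureSet c hc a ha b)
  choose g hg using fun j => hterm (x j)
  choose g' hg' using fun j => hterm (y j)
  have hx : (Term.app f g).eval Q ![c, a] = Q.interp f x := by simp only [Term.eval, hg]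
  have hy : (Term.app f g').eval Q ![c, a] = Q.interp f y := by simp only [Term.eval, hg']
  have hgg : ∀ j, AbsorbsLeft U (g j) ↔ AbsorbsLeft U (g' j) := fun j => by
    rw [← hiff, ← hiff, hg, hg', hxy]
  rw [← hx, ← hy, hiff, hiff, h.absorbsLeft_app_iff, h.absorbsLeft_app_iff]
  simp only [hgg]

theorem eq_of_mem_iff (hQ : Q.IsSimple) {x y : Q.carrier} (hxy : x ∈ U ↔ y ∈ U) : x = y := by
  rcases hQ { rel := fun x y => x ∈ U ↔ y ∈ U
              refl := fun _ => Iff.rfl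
              symm := Iff.symm
              trans := Iff.trans
              compat := h.isClosed_compl_congr } with hθ | hθ
  · exact (hθ x y).1 hxy
  · obtain ⟨c, hc⟩ := h.split.nonempty
    obtain ⟨a, ha⟩ := h.split.exists_notMem
    exact absurd ((hθ c a).1 hc) ha

end MedianCase

end UAlgebra


namespace UAlgebra

variable {σ : Signature} {κ : Type} {E : κ → UAlgebra σ} {X Y Q : UAlgebra σ}

namespace MedianCase

variable {U : Set Q.carrier} (h : MedianCase E Q U)

include h

theorem eval_mem_iff_of_binary (hQ : Q.IsSimple) {c a : Q.carrier} (hc : c ∈ U) (ha : a ∉ U)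
    (f : Term σ 2) : f.eval Q ![c, a] ∈ U ↔ f.eval Q ![a, c] ∉ U := by
  have hU : ∀ u ∈ U, u = c := fun u hu => h.eq_of_mem_iff hQ (iff_of_true hu hc)
  have hO : ∀ q, q ∉ U → q = a := fun q hq => h.eq_of_mem_iff hQ (iff_of_false hq ha)
  have hl : f.eval Q ![c, a] ∈ U ↔ AbsorbsLeft U f := by
    refine ⟨fun hf u hu q => ?_, fun hf => hf c hc a⟩
    by_cases hq : q ∈ U
    · exact h.split.isClosed.eval_mem₂ f hu hq
    · rw [hU u hu, hO q hq]; exact hf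
  have hr : f.eval Q ![a, c] ∈ U ↔ AbsorbsRight U f := by
    refine ⟨fun hf u hu q => ?_, fun hf => hf c hc a⟩
    by_cases hq : q ∈ U
    · exact h.split.isClosed.eval_mem₂ f hq hu
    · rw [hU u hu, hO q hq]; exact hf
  rw [hl, hr]
  refine ⟨h.not_absorbsLeft_and_absorbsRight f, fun hf => ?_⟩
  by_contra hl'
  exact hf (h.absorbsRight_of_not_absorbsLeft hl')

theorem eval_mem_iff_of_compl (hQ : Q.IsSimple) {c a : Q.carrier} (hc : c ∈ U) (ha : a ∉ U)
    {n : ℕ} (t : Term σ n) (J : Finset (Fin n)) :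
    t.eval Q (fun j => if j ∈ J then c else a) ∈ U ↔
      t.eval Q (fun j => if j ∈ J then a else c) ∉ U := by
  have := h.eval_mem_iff_of_binary hQ hc ha (t.subst fun j => if j ∈ J then .var 0 else .var 1)
  rw [Term.eval_subst, Term.eval_subst] at this
  convert this using 5 <;> split <;> rfl

theorem eval_mem_mono (hQ : Q.IsSimple) {c a : Q.carrier} (hc : c ∈ U) (ha : a ∉ U)
    {n : ℕ} (t : Term σ n) {J J' : Finset (Fin n)} (hJ : J ⊆ J')
    (ht : t.eval Q (fun j => if j ∈ J then c else a) ∈ U) :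
    t.eval Q (fun j => if j ∈ J' then c else a) ∈ U := by
  by_contra ht'
  have heval : ∀ z z' : (freePower E).carrier,
      (t.subst fun j => if j ∈ J' then (.var 0 : Term σ 2) else .var 1).eval (freePower E)
        ![z, z'] = t.eval (freePower E) fun j => if j ∈ J' then z else z' := fun z z' => by
    rw [Term.eval_subst]
    congr 1; funext j; split <;> rfl
  refine h.not_outerLeft_and_outerRight
    (t.subst fun j => if j ∈ J' then .var 0 else .var 1) (fun z hz z' hz' => ?_)
    fun z hz z' hz' => ?_
  · rw [heval]
    refine eval_mem_outerPart h.idem h.idem_Q h.split t (J := fun j => j ∉ J)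
      (q := fun j => if j ∈ J then a else c) (fun j hj => ?_)
      ((h.eval_mem_iff_of_compl hQ hc ha t J).1 ht) (fun j => ?_) fun j hj => ?_
    · simpa [hj] using hc
    · split
      exacts [outerPart_subset_freeTwo U hz', hz]
    · simpa [hJ (not_not.1 hj)] using hz'
  · rw [heval]
    refine eval_mem_outerPart h.idem h.idem_Q h.split t (J := fun j => j ∈ J')
      (q := fun j => if j ∈ J' then c else a) (fun j hj => ?_) ht' (fun j => ?_) fun j hj => ?_
    · simpa [hj] using hc
    · split
      exacts [hz, outerPart_subset_freeTwo U hz']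
    · simpa [hj] using hz'

theorem eval_eq_of_singleton (hQ : Q.IsSimple) {c a : Q.carrier} (hc : c ∈ U) (ha : a ∉ U)
    {n : ℕ} (t : Term σ n) {i : Fin n}
    (ht : t.eval Q (fun j => if j ∈ ({i} : Finset (Fin n)) then c else a) ∈ U)
    (x : Fin n → Q.carrier) : t.eval Q x = x i := by
  classical
  refine h.eq_of_mem_iff hQ ?_
  let J : Finset (Fin n) := Finset.univ.filter fun j => x j ∈ U
  have hx : x = fun j => if j ∈ J then c else a := funext fun j =>
    h.eq_of_mem_iff hQ (by by_cases hj : x j ∈ U <;> simp [J, hj, hc, ha])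
  have hx' : (fun j => if j ∈ J then c else a) = fun j => if j ∈ Jᶜ then a else c :=
    funext fun j => by by_cases hj : j ∈ J <;> simp [hj]
  by_cases hi : x i ∈ U
  · refine iff_of_true ?_ hi
    rw [hx]
    exact h.eval_mem_mono hQ hc ha t (by simp [J, hi]) ht
  · refine iff_of_false ?_ hi
    rw [hx, hx', ← h.eval_mem_iff_of_compl hQ hc ha t Jᶜ]
    exact h.eval_mem_mono hQ hc ha t (by simp [J, hi]) ht

/-- Some ternary term satisfies the majority equations with the value `a ∉ U`. -/
theorem exists_median (hQ : Q.IsSimple) (hset : ¬ Q.IsSetAlgebra) {c a : Q.carrier} (hc : c ∈ U)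
    (ha : a ∉ U) : ∃ q : Term σ 3, q.eval Q ![a, a, c] = a ∧ q.eval Q ![a, c, a] = a ∧
      q.eval Q ![c, a, a] = a := by
  classical
  unfold IsSetAlgebra at hset
  push Not at hset
  obtain ⟨n, t, ht⟩ := hset
  have hsing : ∀ i, t.eval Q (fun j => if j ∈ ({i} : Finset (Fin n)) then c else a) ∉ U :=
    fun i hi => (ht i).elim fun x hx => hx (h.eval_eq_of_singleton hQ hc ha t hi x)
  obtain ⟨J, hJ, hmin⟩ := Set.exists_min_image
    {J : Finset (Fin n) | t.eval Q (fun j => if j ∈ J then c else a) ∈ U} Finset.card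
    (Set.toFinite _) ⟨Finset.univ, by simpa [Term.eval_const h.idem_Q] using hc⟩
  rw [Set.mem_ofPred_eq] at hJ
  obtain ⟨j, hj⟩ : J.Nonempty := by
    by_contra hne
    rw [Finset.not_nonempty_iff_eq_empty] at hne
    subst hne
    simp only [Finset.notMem_empty, if_false, Term.eval_const h.idem_Q] at hJ
    exact ha hJ
  have herase : t.eval Q (fun i => if i ∈ J.erase j then c else a) ∉ U := fun he =>
    absurd (hmin _ he) (not_le.2 (Finset.card_erase_lt_of_mem hj))
  have hcompl := (h.eval_mem_iff_of_compl hQ hc ha t J).1 hJ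
  have hO : ∀ q, q ∉ U → q = a := fun q hq => h.eq_of_mem_iff hQ (iff_of_false hq ha)
  let q : Term σ 3 := t.subst fun i => if i = j then .var 0 else if i ∈ J then .var 1 else .var 2
  have hq : ∀ x y z, q.eval Q ![x, y, z] =
      t.eval Q fun i => if i = j then x else if i ∈ J then y else z := fun x y z => by
    rw [Term.eval_subst]
    congr 1; funext i; split
    · rfl
    · split <;> rfl
  refine ⟨q, hO _ ?_, hO _ ?_, hO _ ?_⟩ <;> rw [hq]
  · convert hcompl using 4 with i
    by_cases hi : i = j
    · simp [hi, hj]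
    · simp [hi]
  · convert herase using 4 with i
    by_cases hi : i = j <;> simp [hi]
  · convert hsing j using 4 with i
    by_cases hi : i = j <;> simp [hi]

theorem nearUnanimous (hfin : ∀ k, Finite (E k).carrier) (hQ : Q.IsSimple)
    (hset : ¬ Q.IsSetAlgebra) (k₁ k₂ : κ) : NearUnanimous (E k₁) (E k₂) Q U := by
  intro x y x' y' a ha
  obtain ⟨c, hc⟩ := h.split.nonempty
  have hca : ∀ q, q = c ∨ q = a := fun q => by
    by_cases hq : q ∈ U
    · exact Or.inl (h.eq_of_mem_iff hQ (iff_of_true hq hc))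
    · exact Or.inr (h.eq_of_mem_iff hQ (iff_of_false hq ha))
  have hidQ := fun t x => Term.eval_const₃ h.idem_Q t x
  have := hfin k₁
  have := hfin k₂
  obtain ⟨q, hq₁, hq₂, hq₃⟩ := h.exists_median hQ hset hc ha
  obtain ⟨r, ⟨hr₁, hr₂, hr₃⟩, hrx⟩ : ∃ r : Term σ 3, (r.eval Q ![a, a, c] = a ∧
      r.eval Q ![a, c, a] = a ∧ r.eval Q ![c, a, a] = a) ∧ r.eval (E k₁) ![y, x, x] = x := by
    refine (h.slf k₁).exists_term_of_absorbs (h.idem k₁) ![y, x, x] 1 (weak := fun _ => True)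
      ⟨q, hq₁, hq₂, hq₃⟩ (q.comp₃ (.var 1) (.var 0) (.var 0))
      (fun t ht => ⟨q.comp₃ t (.var 1) (.var 2), ?_, ?_⟩) trivial (fun _ _ => trivial)
      fun t s ht _ => ?_
    · obtain ⟨h₁, h₂, h₃⟩ := ht
      simp [*]
    · simp
    · obtain ⟨h₁, h₂, h₃⟩ := ht
      have hqa : ∀ v, q.eval Q ![v, a, a] = a := fun v => by
        rcases hca v with rfl | rfl <;> simp [*]
      simp [*]
  obtain ⟨s, ⟨-, hs, hsx⟩, hsx'⟩ : ∃ s : Term σ 3, ((s.eval Q ![a, c, a] = a ∧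
      s.eval Q ![c, a, a] = a) ∧ s.eval Q ![a, a, c] = a ∧ s.eval (E k₁) ![y, x, x] = x) ∧
      s.eval (E k₂) ![x', y', x'] = x' := by
    have hid₁ := fun t x => Term.eval_const₃ (h.idem k₁) t x
    have hra : ∀ v, r.eval Q ![a, v, a] = a := fun v => by
      rcases hca v with rfl | rfl <;> simp [*]
    refine (h.slf k₂).exists_term_of_absorbs (h.idem k₂) ![x', y', x'] 2
      (weak := fun t => t.eval (E k₁) ![y, x, x] = x)
      ⟨r, ⟨hr₂, hr₃⟩, hr₁, hrx⟩ (r.comp₃ (.var 0) (.var 1) (.var 0))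
      (fun t ht => ⟨r.comp₃ (.var 0) t (.var 2), ?_, ?_⟩) rfl (fun _ h => h.2.2)
      fun t s ht hs => ?_
    · obtain ⟨⟨h₁, h₂⟩, h₃, h₄⟩ := ht
      simp [*]
    · simp
    · obtain ⟨⟨h₁, h₂⟩, h₃, h₄⟩ := ht
      simp [*]
  exact mem_forkClosure_of_term hc s hsx hsx' hs

end MedianCase

/-- The main dichotomy for simple algebras with a generating split. -/
theorem centralMaltsev_or_nearUnanimous [Finite κ] (hfin : ∀ k, Finite (E k).carrier)
    (hid : ∀ k, (E k).Idempotent) (hslf : ∀ k, (E k).SLF) [Finite Q.carrier] (hsat : Sat E Q)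
    (hQid : Q.Idempotent) (hQslf : Q.SLF) (hQ : Q.IsSimple) (hset : ¬ Q.IsSetAlgebra)
    {U : Set Q.carrier} (hU : IsGeneratingSplit Q U) :
    CentralMaltsev Q ∨ ∀ k₁ k₂, NearUnanimous (E k₁) (E k₂) Q U := by
  by_cases hb : gx E ∈ outerPart E U
  · obtain ⟨b, hb, hb'⟩ := hb
    exact centralMaltsev_or_nearUnanimous_of_mem hid hsat hQid hQ hU hb hb'
  · have : Finite (freePower E).carrier := inferInstance
    exact Or.inr (MedianCase.nearUnanimous ⟨hid, hslf, this, hQid, hQslf, ‹_›, hU, hb⟩ hfin hQ hset)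

end UAlgebra

namespace UAlgebra

variable {σ : Signature} {κ : Type} {E : κ → UAlgebra σ} {A B Q : UAlgebra σ}

/-! ### Minimal splits of two-generated subalgebras -/

theorem Congruence.IsMaximal.comap {θ : Congruence B} (hθ : θ.IsMaximal)
    {φ : A.carrier → B.carrier} (hφ : A.IsHom B φ) (hb : Function.Bijective φ) :
    (θ.comap hφ).IsMaximal := by
  let e := Equiv.ofBijective φ hb
  have he : ∀ x, φ (e.symm x) = x := e.apply_symm_apply
  have he' : ∀ x, e.symm (φ x) = x := e.symm_apply_apply
  have hψ : B.IsHom A e.symm := fun f x => hb.1 (by rw [he, hφ f]; simp only [he])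
  refine ⟨fun hfull => hθ.1 fun x y => ?_, fun η hle hη x y hxy => ?_⟩
  · have : θ.rel (φ (e.symm x)) (φ (e.symm y)) := hfull _ _
    rwa [he, he] at this
  · refine hθ.2 (η.comap hψ) (fun u v huv => hle _ _ ?_) (fun hfull => hη fun u v => ?_) _ _ ?_
    · change θ.rel (φ _) (φ _)
      rwa [he, he]
    · have : η.rel (e.symm (φ u)) (e.symm (φ v)) := hfull _ _
      rwa [he', he'] at this
    · change η.rel (e.symm _) (e.symm _)
      rwa [he', he']

theorem IsSetAlgebra.of_injective (h : B.IsSetAlgebra) {φ : A.carrier → B.carrier}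
    (hφ : A.IsHom B φ) (hi : Function.Injective φ) : A.IsSetAlgebra := fun n t => by
  obtain ⟨i, hi'⟩ := h n t
  exact ⟨i, fun x => hi (by rw [hφ.eval, hi'])⟩

theorem eq_isMaximal [Nontrivial Q.carrier] (hQ : Q.IsSimple) : (Congruence.eq Q).IsMaximal := by
  obtain ⟨x, y, hxy⟩ := exists_pair_ne Q.carrier
  refine ⟨fun h => hxy (h x y), fun η _ hη x y h => ?_⟩
  exact (((hQ η).resolve_right hη) x y).1 h

theorem isHom_quotMap {φ : A.carrier → B.carrier} (hφ : A.IsHom B φ) (θ : Congruence B) :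
    ∃ ψ : (A.quot (θ.comap hφ)).carrier → (B.quot θ).carrier,
      (A.quot (θ.comap hφ)).IsHom (B.quot θ) ψ ∧ Function.Injective ψ := by
  refine ⟨Quotient.lift (fun x => toQuot θ (φ x)) fun x y hxy => (toQuot_eq_iff θ).2 hxy,
    fun f x => ?_, ?_⟩
  · choose y hy using fun j => toQuot_surjective _ (x j)
    obtain rfl : (fun j => toQuot (θ.comap hφ) (y j)) = x := funext hy
    rw [← isHom_toQuot (θ.comap hφ) f y]
    exact (congrArg (toQuot θ) (hφ f y)).trans (isHom_toQuot θ f fun j => φ (y j))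
  · rintro ⟨x⟩ ⟨y⟩ hxy
    exact (toQuot_eq_iff (θ.comap hφ)).2 ((toQuot_eq_iff θ).1 hxy)

/-- A pair of generators identifies a two-generated algebra with a subalgebra of itself. -/
theorem bijective_val_of_generates {c a : Q.carrier} (h : ∀ b, b ∈ Q.ClosureSet {c, a}) :
    Function.Bijective (Subtype.val : (Q.Sg {c, a}).carrier → Q.carrier) :=
  ⟨Subtype.val_injective, fun b => ⟨⟨b, h b⟩, rfl⟩⟩

theorem mem_closureSet_subalg {S : Set A.carrier} {hS : A.IsClosed S}
    {c a b : (A.subalg S hS).carrier} (h : b.1 ∈ A.ClosureSet {c.1, a.1}) :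
    b ∈ (A.subalg S hS).ClosureSet {c, a} := by
  obtain ⟨g, hg⟩ := exists_eval_of_mem_pair h
  have : g.eval (A.subalg S hS) ![c, a] = b :=
    Subtype.ext (((isHom_val hS).eval₂ g c a).trans hg)
  rw [← this]
  exact (isClosed_closureSet _).eval_mem₂ g (left_mem_closureSet _ _) (right_mem_closureSet _ _)

theorem OmitsType1.not_isSetAlgebra (h : A.OmitsType1) {c a : A.carrier} (hca : c ≠ a)
    {θ : Congruence (A.Sg {c, a})} (hθ : θ.IsMaximal) :
    ¬ ((A.Sg {c, a}).quot θ).IsSetAlgebra := by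
  intro hset
  have hgen : ∀ b, b ∈ (A.Sg {c, a}).ClosureSet {A.sgA c a, A.sgB c a} := fun b =>
    mem_closureSet_subalg b.2
  have hv := isHom_val ((A.Sg {c, a}).closureSet_isClosed {A.sgA c a, A.sgB c a})
  obtain ⟨ψ, hψ, hi⟩ := isHom_quotMap hv θ
  exact h _ (A.closureSet_isClosed {c, a}) (A.sgA c a) (A.sgB c a)
    ⟨fun e => hca (congrArg Subtype.val e), θ.comap hv,
      hθ.comap hv (bijective_val_of_generates hgen), hset.of_injective hψ hi⟩

/-- Two closed sets `D ⊂ V` give rise to a generating split of the subalgebra generated by some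
`c ∈ D` and `a ∈ V \ D`. -/
theorem exists_isGeneratingSplit [Finite A.carrier] {D V : Set A.carrier} (hD : A.IsClosed D)
    (hV : A.IsClosed V) (hDV : D ⊆ V) (hne : D.Nonempty) {a₀ : A.carrier} (ha₀ : a₀ ∈ V)
    (ha₀' : a₀ ∉ D) : ∃ c ∈ D, ∃ a ∈ V, a ∉ D ∧
      IsGeneratingSplit (A.Sg {c, a}) {b | b.1 ∈ D} := by
  obtain ⟨c₀, hc₀⟩ := hne
  obtain ⟨⟨c, a⟩, ⟨hc, ha, ha'⟩, hmin⟩ := Set.exists_min_image (D ×ˢ (V \ D))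
    (fun w => (A.ClosureSet {w.1, w.2}).ncard) (Set.toFinite _) ⟨(c₀, a₀), hc₀, ha₀, ha₀'⟩
  refine ⟨c, hc, a, ha, ha', hD.preimage (isHom_val _), ⟨A.sgA c a, hc⟩, ⟨A.sgB c a, ha'⟩, ?_⟩
  intro c' hc' a' ha' b
  have hsub : A.ClosureSet {c'.1, a'.1} ⊆ A.ClosureSet {c, a} :=
    closureSet_pair_subset (isClosed_closureSet _) c'.2 a'.2
  have hV' : a'.1 ∈ V := closureSet_pair_subset hV (hDV hc) ha a'.2
  have := Set.eq_of_subset_of_ncard_le hsub (hmin (c'.1, a'.1) ⟨hc', hV', ha'⟩) (Set.toFinite _)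
  exact mem_closureSet_subalg (this.ge b.2)

theorem IsGeneratingSplit.mem_of_rel (hB : B.Idempotent) {U : Set B.carrier}
    (hU : IsGeneratingSplit B U) {θ : Congruence B} (hθ : ¬ θ.IsFull) {x y : B.carrier}
    (hxy : θ.rel x y) (hx : x ∈ U) : y ∈ U := by
  by_contra hy
  have hcl : B.IsClosed {z | θ.rel x z} := fun f z hz => by
    have := θ.compat f (fun _ => x) z hz
    rwa [hB f x] at this
  have hall : ∀ z, θ.rel x z := hU.mem_of_isClosed hcl hx hy (θ.refl x) hxy
  exact hθ fun u v => θ.trans (θ.symm (hall u)) (hall v)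

theorem IsGeneratingSplit.preimage_image (hB : B.Idempotent) {U : Set B.carrier}
    (hU : IsGeneratingSplit B U) {θ : Congruence B} (hθ : ¬ θ.IsFull) :
    toQuot θ ⁻¹' (toQuot θ '' U) = U := by
  refine Set.Subset.antisymm ?_ (Set.subset_preimage_image _ _)
  rintro x ⟨y, hy, hyx⟩
  exact hU.mem_of_rel hB hθ ((toQuot_eq_iff θ).1 hyx) hy

theorem IsGeneratingSplit.image (hB : B.Idempotent) {U : Set B.carrier}
    (hU : IsGeneratingSplit B U) {θ : Congruence B} (hθ : ¬ θ.IsFull) :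
    IsGeneratingSplit (B.quot θ) (toQuot θ '' U) where
  isClosed := hU.isClosed.image (isHom_toQuot θ)
  nonempty := hU.nonempty.image _
  exists_notMem := by
    obtain ⟨a, ha⟩ := hU.exists_notMem
    refine ⟨toQuot θ a, fun h => ha ?_⟩
    rw [← hU.preimage_image hB hθ]
    exact h
  mem_closureSet := by
    rintro _ ⟨c, hc, rfl⟩ a ha b
    obtain ⟨a, rfl⟩ := toQuot_surjective θ a
    obtain ⟨b, rfl⟩ := toQuot_surjective θ b
    exact hU.mem_of_isClosed ((isClosed_closureSet _).preimage (isHom_toQuot θ)) hc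
      (a := a) (fun h => ha ⟨a, h, rfl⟩) (left_mem_closureSet _ _) (right_mem_closureSet _ _) b

/-- The dichotomy for a two-generated algebra with a generating split. -/
theorem exists_centralMaltsev_or_nearUnanimous [Finite κ] (hfin : ∀ k, Finite (E k).carrier)
    (hid : ∀ k, (E k).Idempotent) (hslf : ∀ k, (E k).SLF) {k : κ} (homit : (E k).OmitsType1)
    {c a : (E k).carrier} (hca : c ≠ a) {U : Set ((E k).Sg {c, a}).carrier}
    (hU : IsGeneratingSplit ((E k).Sg {c, a}) U) :
    (∃ θ : Congruence ((E k).Sg {c, a}), θ.IsMaximal ∧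
      CentralMaltsev (((E k).Sg {c, a}).quot θ)) ∨
    ∀ k₁ k₂, NearUnanimous (E k₁) (E k₂) ((E k).Sg {c, a}) U := by
  have := hfin k
  have hv : ((E k).Sg {c, a}).IsHom (E k) Subtype.val := isHom_val _
  have hfB : Finite ((E k).Sg {c, a}).carrier := Finite.of_injective _ Subtype.val_injective
  have : Nontrivial ((E k).Sg {c, a}).carrier :=
    ⟨(E k).sgA c a, (E k).sgB c a, fun h => hca (congrArg Subtype.val h)⟩
  have hidB : ((E k).Sg {c, a}).Idempotent := (hid k).of_injective hv Subtype.val_injective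
  obtain ⟨θ, hθ⟩ := exists_isMaximal_congruence (A := (E k).Sg {c, a})
  have hs := toQuot_surjective θ
  have hq := isHom_toQuot θ
  have : Finite (((E k).Sg {c, a}).quot θ).carrier := Finite.of_surjective _ hs
  rcases centralMaltsev_or_nearUnanimous hfin hid hslf
    (((sat_self E k).of_injective hv Subtype.val_injective).of_surjective hq hs)
    (hidB.of_surjective hq hs) (((hslf k).of_injective hv Subtype.val_injective).of_surjective
      hidB hq hs) (isSimple_quot hθ) (homit.not_isSetAlgebra hca hθ) (hU.image hidB hθ.1)
    with h | h
  · exact Or.inl ⟨θ, hθ, h⟩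
  · have hpre := hU.preimage_image hidB hθ.1
    refine Or.inr fun k₁ k₂ => ?_
    have := (h k₁ k₂).lift (hid k₁) (hid k₂) hq hs (hpre.symm ▸ hU)
    rwa [hpre] at this

/-! ### Thin affine edges -/

theorem exists_minorityCondition [Finite κ] (hfin : ∀ k, Finite (E k).carrier)
    (hid : ∀ k, (E k).Idempotent) (hslf : ∀ k, (E k).SLF) :
    ∃ p, IsLeftMaltsev E p ∧ MinorityCondition (QuotSubClass (Set.range E)) p := by
  obtain ⟨p, hp, huniv⟩ := exists_isLeftMaltsev_universal (E := E)
  refine ⟨p, hp, ?_, ?_⟩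
  · rintro _ ⟨_, ⟨k, rfl⟩, S, hS, θ, rfl⟩ x y
    have hsat := ((sat_self E k).of_injective (isHom_val hS)
      Subtype.val_injective).of_surjective (isHom_toQuot θ) (toQuot_surjective θ)
    rw [hp.eval_sat hsat]
  · rintro _ ⟨_, ⟨k, rfl⟩, S, hS, η, rfl⟩ a b θ - ⟨-, R, _, _, _, _, -, t, ht⟩
    have := hfin k
    have hv := isHom_val ((((E k).subalg S hS).quot η).closureSet_isClosed {a, b})
    have hsat : Sat E (((((E k).subalg S hS).quot η).Sg {a, b}).quot θ) :=
      ((((sat_self E k).of_injective (isHom_val hS) Subtype.val_injective).of_surjective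
        (isHom_toQuot η) (toQuot_surjective η)).of_injective hv
        Subtype.val_injective).of_surjective (isHom_toQuot θ) (toQuot_surjective θ)
    have hidC : (((((E k).subalg S hS).quot η).Sg {a, b}).quot θ).Idempotent :=
      ((((hid k).of_injective (isHom_val hS) Subtype.val_injective).of_surjective
        (isHom_toQuot η) (toQuot_surjective η)).of_injective hv
        Subtype.val_injective).of_surjective (isHom_toQuot θ) (toQuot_surjective θ)
    have : Finite ((E k).subalg S hS).carrier := Finite.of_injective _ Subtype.val_injective
    have : Finite (((E k).subalg S hS).quot η).carrier :=
      Finite.of_surjective _ (toQuot_surjective η)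
    have : Finite ((((E k).subalg S hS).quot η).Sg {a, b}).carrier :=
      Finite.of_injective _ Subtype.val_injective
    have : Finite (((((E k).subalg S hS).quot η).Sg {a, b}).quot θ).carrier :=
      Finite.of_surjective _ (toQuot_surjective θ)
    have hM := huniv _ hidC hsat (exists_isLeftMaltsev_of_maltsev hid hslf hidC t
      fun x y => ⟨by rw [ht]; abel, by rw [ht]; abel⟩)
    exact fun x _ y _ => ⟨hp.eval_sat hsat x y, hM y x⟩

theorem isThinAffEdge_of_centralMaltsev [Finite κ] (hfin : ∀ k, Finite (E k).carrier)
    (hid : ∀ k, (E k).Idempotent) (hslf : ∀ k, (E k).SLF) {k : κ}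
    {c a : (E k).carrier} {U : Set ((E k).Sg {c, a}).carrier}
    (hU : IsGeneratingSplit ((E k).Sg {c, a}) U) (hc : (E k).sgA c a ∈ U)
    (ha : (E k).sgB c a ∉ U) {θ : Congruence ((E k).Sg {c, a})} (hθ : θ.IsMaximal)
    (h : CentralMaltsev (((E k).Sg {c, a}).quot θ)) :
    IsThinAffEdge (QuotSubClass (Set.range E)) (E k) c a := by
  obtain ⟨p, hp, hpm⟩ := exists_minorityCondition hfin hid hslf
  refine ⟨⟨p, hpm, hp k a c⟩, fun t ht => ?_⟩
  have := hfin k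
  have hv : ((E k).Sg {c, a}).IsHom (E k) Subtype.val := isHom_val _
  have hidB : ((E k).Sg {c, a}).Idempotent := (hid k).of_injective hv Subtype.val_injective
  have : Finite ((E k).Sg {c, a}).carrier := Finite.of_injective _ Subtype.val_injective
  set Q := ((E k).Sg {c, a}).quot θ
  have hq : ((E k).Sg {c, a}).IsHom Q (toQuot θ) := isHom_toQuot θ
  have hidQ : Q.Idempotent := hidB.of_surjective hq (toQuot_surjective θ)
  have : Finite Q.carrier := Finite.of_surjective _ (toQuot_surjective θ)
  set c' : Q.carrier := toQuot θ ((E k).sgA c a)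
  set a' : Q.carrier := toQuot θ ((E k).sgB c a)
  have hne : c' ≠ a' := fun e =>
    ha (hU.mem_of_rel hidB hθ.1 ((toQuot_eq_iff θ).1 e) hc)
  have : Nontrivial Q.carrier := ⟨c', a', hne⟩
  have hv' := isHom_val (Q.closureSet_isClosed {c', a'})
  have hgen : ∀ b, b ∈ Q.ClosureSet {c', a'} := fun b => by
    obtain ⟨b, rfl⟩ := toQuot_surjective θ b
    exact closureSet_pair_subset ((isClosed_closureSet {c', a'}).preimage hq)
      (left_mem_closureSet c' a') (right_mem_closureSet c' a') (hU.mem_closureSet _ hc _ ha b)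
  let η : Congruence (Q.Sg {c', a'}) := (Congruence.eq Q).comap hv'
  have hη : η.IsMaximal :=
    (eq_isMaximal (isSimple_quot hθ)).comap hv' (bijective_val_of_generates hgen)
  have hqη := isHom_toQuot η
  have hne' : toQuot η (Q.sgA c' a') ≠ toQuot η (Q.sgB c' a') := fun e =>
    hne ((toQuot_eq_iff η).1 e)
  have : Nontrivial ((Q.Sg {c', a'}).quot η).carrier := ⟨_, _, hne'⟩
  have : Finite (Q.Sg {c', a'}).carrier := Finite.of_injective _ Subtype.val_injective
  have : Finite ((Q.Sg {c', a'}).quot η).carrier := Finite.of_surjective _ (toQuot_surjective η)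
  have haff : ((Q.Sg {c', a'}).quot η).IsAffineAlgebra :=
    ((h.of_injective hv' Subtype.val_injective).of_surjective hqη
      (toQuot_surjective η)).isAffineAlgebra
      ((hidQ.of_injective hv' Subtype.val_injective).of_surjective hqη (toQuot_surjective η))
  have ht₁ := (ht.2 Q ⟨E k, ⟨k, rfl⟩, _, _, θ, rfl⟩ c' a' η hne ⟨hη, haff⟩
    (Q.qb c' a' η) (Or.inr rfl) (Q.qa c' a' η) (Or.inl rfl)).2
  have ht₂ : t.eval Q ![c', c', a'] = a' :=
    (hv'.eval₃ t (Q.sgA c' a') (Q.sgA c' a') (Q.sgB c' a')).symm.trans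
      ((toQuot_eq_iff η).1 ((hqη.eval₃ t _ _ _).trans ht₁))
  have ht₃ : θ.rel (t.eval ((E k).Sg {c, a}) ![(E k).sgA c a, (E k).sgA c a, (E k).sgB c a])
      ((E k).sgB c a) := (toQuot_eq_iff θ).1 ((hq.eval₃ t _ _ _).trans ht₂)
  have ht₄ := hU.mem_closureSet _ hc _ (fun h' => ha (hU.mem_of_rel hidB hθ.1 ht₃ h'))
    ((E k).sgB c a)
  refine closureSet_pair_subset ((isClosed_closureSet _).preimage hv) ?_ ?_ ht₄
  · exact left_mem_closureSet c _
  · exact (congrArg (· ∈ (E k).ClosureSet _) (hv.eval₃ t _ _ _)).mpr (right_mem_closureSet c _)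

end UAlgebra

namespace UAlgebra

variable {σ : Signature} {κ : Type} {E : κ → UAlgebra σ} {n : ℕ} {k : Fin n → κ}

/-! ### Representations -/

theorem isClosed_slice (hid : ∀ k, (E k).Idempotent) {S : Set (pi fun i => E (k i)).carrier}
    (hS : (pi fun i => E (k i)).IsClosed S) (w : (pi fun i => E (k i)).carrier) (i : Fin n) :
    (E (k i)).IsClosed {z | ∃ v ∈ S, (∀ j < i, v j = w j) ∧ v i = z} := fun f z hz => by
  choose v hv hvw hvz using hz
  refine ⟨_, hS f v hv, fun j hj => ?_, ?_⟩
  · change (E (k j)).interp f (fun l => v l j) = w j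
    simp only [fun l => hvw l j hj]
    exact hid (k j) f (w j)
  · exact congrArg ((E (k i)).interp f) (funext hvz)

/-- If a set of tuples is closed and contains the relevant thin affine forks, then the target of a
thin affine edge can be attained. -/
theorem exists_mem_of_isThinAffEdge [Finite κ] (hfin : ∀ k, Finite (E k).carrier)
    (hid : ∀ k, (E k).Idempotent) (hslf : ∀ k, (E k).SLF)
    {S : Set (pi fun i => E (k i)).carrier} (hS : (pi fun i => E (k i)).IsClosed S)
    {w r u v : (pi fun i => E (k i)).carrier} {i : Fin n}
    (hr : r ∈ S) (hu : u ∈ S) (hv : v ∈ S) (hrw : ∀ j < i, r j = w j) (huv : ∀ j < i, u j = v j)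
    (hru : r i = u i)
    (h : IsThinAffEdge (QuotSubClass (Set.range E)) (E (k i)) (u i) (v i)) :
    ∃ s ∈ S, (∀ j < i, s j = w j) ∧ s i = v i := by
  obtain ⟨p, hp, hpm⟩ := exists_minorityCondition hfin hid hslf
  refine closureSet_pair_subset (isClosed_slice hid hS w i) ⟨r, hr, hrw, hru⟩
    ⟨p.eval _ ![r, u, v], hS.eval_mem₃ p hr hu hv, fun j hj => ?_, ?_⟩ (h.2 p hpm)
  · rw [eval_pi₃, hrw j hj, huv j hj, hp]
  · rw [eval_pi₃, hru]

/-- Near unanimity makes it possible to attain the values of tuples with two additional prescribed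
coordinates. -/
theorem exists_mem_of_nearUnanimous (hid : ∀ k, (E k).Idempotent)
    {S : Set (pi fun i => E (k i)).carrier} (hS : (pi fun i => E (k i)).IsClosed S)
    {w s₁ s₂ : (pi fun i => E (k i)).carrier} {i j₁ j₂ : Fin n} {I : Finset (Fin n)} (hne : j₁ ≠ j₂)
    (hI : ∀ j ∈ I, j < i) (hj₁ : j₁ ∈ I) (hj₂ : j₂ ∈ I) {c a : (E (k i)).carrier}
    {U : Set ((E (k i)).Sg {c, a}).carrier}
    (hU : ∀ b ∈ U, ∃ v ∈ S, (∀ j < i, v j = w j) ∧ v i = b.1)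
    (ha : (E (k i)).sgB c a ∉ U)
    (h : NearUnanimous (E (k j₁)) (E (k j₂)) ((E (k i)).Sg {c, a}) U)
    (hs₁ : s₁ ∈ S) (hs₁' : ∀ j ∈ I.erase j₁, s₁ j = w j) (hs₁i : s₁ i = a)
    (hs₂ : s₂ ∈ S) (hs₂' : ∀ j ∈ I.erase j₂, s₂ j = w j) (hs₂i : s₂ i = a) :
    ∃ v ∈ S, (∀ j ∈ I, v j = w j) ∧ v i = a := by
  obtain ⟨v, hv, hvw, hv₁, hv₂, hvi⟩ : ((w j₁, w j₂), (E (k i)).sgB c a) ∈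
      {ζ : (((E (k j₁)).prod (E (k j₂))).prod ((E (k i)).Sg {c, a})).carrier |
        ∃ v ∈ S, (∀ j ∈ I, j ≠ j₁ → j ≠ j₂ → v j = w j) ∧ v j₁ = ζ.1.1 ∧ v j₂ = ζ.1.2 ∧
          v i = ζ.2.1} := by
    refine closureSet_subset ?_ ?_ (h (w j₁) (s₁ j₁) (w j₂) (s₂ j₂) _ ha)
    · intro f ζ hζ
      choose v hv hvw hv₁ hv₂ hvi using hζ
      refine ⟨_, hS f v hv, fun j hj hj₁ hj₂ => ?_, congrArg ((E (k j₁)).interp f) (funext hv₁),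
        congrArg ((E (k j₂)).interp f) (funext hv₂), congrArg ((E (k i)).interp f) (funext hvi)⟩
      change (E (k j)).interp f (fun l => v l j) = w j
      simp only [fun l => hvw l j hj hj₁ hj₂]
      exact hid (k j) f (w j)
    · rintro ⟨ζ, b⟩ (⟨hζ, hb⟩ | hζ | hζ)
      · obtain rfl : ζ = (w j₁, w j₂) := hζ
        obtain ⟨v, hv, hvw, hvi⟩ := hU b hb
        exact ⟨v, hv, fun j hj _ _ => hvw j (hI j hj), hvw _ (hI _ hj₁), hvw _ (hI _ hj₂), hvi⟩
      · obtain ⟨rfl, rfl⟩ := Prod.ext_iff.1 hζ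
        exact ⟨s₁, hs₁, fun j hj hj₁ _ => hs₁' j (Finset.mem_erase.2 ⟨hj₁, hj⟩), rfl,
          hs₁' _ (Finset.mem_erase.2 ⟨hne.symm, hj₂⟩), hs₁i⟩
      · obtain ⟨rfl, rfl⟩ := Prod.ext_iff.1 hζ
        exact ⟨s₂, hs₂, fun j hj _ hj₂ => hs₂' j (Finset.mem_erase.2 ⟨hj₂, hj⟩),
          hs₂' _ (Finset.mem_erase.2 ⟨hne, hj₁⟩), rfl, hs₂i⟩
  refine ⟨v, hv, fun j hj => ?_, hvi⟩
  by_cases h₁ : j = j₁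
  · subst h₁; exact hv₁
  by_cases h₂ : j = j₂
  · subst h₂; exact hv₂
  exact hvw j hj h₁ h₂

theorem closureSet_eq_of_representation [Finite κ] (hfin : ∀ k, Finite (E k).carrier)
    (hid : ∀ k, (E k).Idempotent) (hslf : ∀ k, (E k).SLF) (homit : ∀ k, (E k).OmitsType1)
    {R R' : Set (pi fun i => E (k i)).carrier} (hR : (pi fun i => E (k i)).IsClosed R)
    (hR' : R' ⊆ R)
    (hfork : ∀ (i : Fin n) (a b : (E (k i)).carrier),
      IsThinAffEdge (QuotSubClass (Set.range E)) (E (k i)) a b →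
      (∃ u ∈ R, ∃ v ∈ R, u i = a ∧ v i = b ∧ ∀ j : Fin n, j < i → u j = v j) →
      ∃ u ∈ R', ∃ v ∈ R', u i = a ∧ v i = b ∧ ∀ j : Fin n, j < i → u j = v j)
    (hproj : ∀ I : Finset (Fin n), I.card ≤ 3 → ∀ u ∈ R, ∃ v ∈ R', ∀ i ∈ I, v i = u i) :
    (pi fun i => E (k i)).ClosureSet R' = R := by
  set S := (pi fun i => E (k i)).ClosureSet R'
  have hS : (pi fun i => E (k i)).IsClosed S := isClosed_closureSet R'
  have hR'S : R' ⊆ S := subset_closureSet R'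
  have hSR : S ⊆ R := closureSet_subset hR hR'
  have step : ∀ (i : Fin n), ∀ w ∈ R, (∃ v ∈ S, ∀ j < i, v j = w j) →
      ∃ v ∈ S, (∀ j < i, v j = w j) ∧ v i = w i := by
    rintro i w hw ⟨v₀, hv₀, hv₀w⟩
    by_contra hcon
    have := hfin (k i)
    obtain ⟨c, ⟨r, hr, hrw, rfl⟩, a, ⟨u, hu, huw, rfl⟩, ha, hU⟩ := exists_isGeneratingSplit
      (isClosed_slice hid hS w i) (isClosed_slice hid hR w i)
      (fun z ⟨v, hv, hvz⟩ => ⟨v, hSR hv, hvz⟩) ⟨v₀ i, v₀, hv₀, hv₀w, rfl⟩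
      (a₀ := w i) ⟨w, hw, fun _ _ => rfl, rfl⟩ hcon
    have hne : r i ≠ u i := fun e => ha ⟨r, hr, hrw, e⟩
    rcases exists_centralMaltsev_or_nearUnanimous hfin hid hslf (homit (k i)) hne hU
      with ⟨θ, hθ, h⟩ | h
    · have hthin := isThinAffEdge_of_centralMaltsev hfin hid hslf hU ⟨r, hr, hrw, rfl⟩ ha hθ h
      obtain ⟨u', hu', v', hv', hui, hvi, huv⟩ := hfork i _ _ hthin
        ⟨r, hSR hr, u, hu, rfl, rfl, fun j hj => (hrw j hj).trans (huw j hj).symm⟩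
      rw [← hui, ← hvi] at hthin
      obtain ⟨s, hs, hsw, hsi⟩ := exists_mem_of_isThinAffEdge hfin hid hslf hS hr (hR'S hu')
        (hR'S hv') hrw huv hui.symm hthin
      exact ha ⟨s, hs, hsw, hsi.trans hvi⟩
    · have key : ∀ I : Finset (Fin n), (∀ j ∈ I, j < i) →
          ∃ v ∈ S, (∀ j ∈ I, v j = w j) ∧ v i = u i := by
        intro I
        induction I using Finset.strongInduction with
        | H I ih =>
          intro hI
          by_cases hcard : I.card ≤ 2
          · obtain ⟨v, hv, hvu⟩ := hproj (insert i I)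
              ((Finset.card_insert_le i I).trans (by omega)) u hu
            exact ⟨v, hR'S hv, fun j hj => (hvu j (Finset.mem_insert_of_mem hj)).trans
              (huw j (hI j hj)), hvu i (Finset.mem_insert_self i I)⟩
          obtain ⟨j₁, hj₁, j₂, hj₂, hj⟩ := Finset.one_lt_card.1 (by omega : 1 < I.card)
          obtain ⟨s₁, hs₁, hs₁', hs₁i⟩ := ih _ (Finset.erase_ssubset hj₁) fun j hj =>
            hI j (Finset.mem_of_mem_erase hj)
          obtain ⟨s₂, hs₂, hs₂', hs₂i⟩ := ih _ (Finset.erase_ssubset hj₂) fun j hj =>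
            hI j (Finset.mem_of_mem_erase hj)
          exact exists_mem_of_nearUnanimous hid hS hj hI hj₁ hj₂ (fun b hb => hb) ha
            (h (k j₁) (k j₂)) hs₁ hs₁' hs₁i hs₂ hs₂' hs₂i
      obtain ⟨v, hv, hvw, hvi⟩ := key (Finset.univ.filter (· < i)) (by simp)
      exact ha ⟨v, hv, fun j hj => hvw j (by simpa using hj), hvi⟩
  have main : ∀ m ≤ n, ∀ w ∈ R, ∃ v ∈ S, ∀ j : Fin n, j.val < m → v j = w j := by
    intro m
    induction m with
    | zero =>
      intro _ w hw
      obtain ⟨v, hv, -⟩ := hproj ∅ (by simp) w hw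
      exact ⟨v, hR'S hv, fun j hj => absurd hj (Nat.not_lt_zero _)⟩
    | succ m ih =>
      intro hm w hw
      obtain ⟨v, hv, hvw⟩ := ih (Nat.le_of_succ_le hm) w hw
      obtain ⟨v, hv, hvw, hvm⟩ := step ⟨m, hm⟩ w hw ⟨v, hv, fun j hj => hvw j hj⟩
      refine ⟨v, hv, fun j hj => ?_⟩
      rcases Nat.lt_succ_iff_lt_or_eq.1 hj with h | h
      · exact hvw j h
      · obtain rfl : j = ⟨m, hm⟩ := Fin.ext h
        exact hvm
  refine hSR.antisymm fun w hw => ?_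
  obtain ⟨v, hv, hvw⟩ := main n le_rfl w hw
  obtain rfl : v = w := funext fun j => hvw j j.2
  exact hv

end UAlgebra


/-- for a subdirect product `R` of semilattice free algebras from
a finite class `K` closed under subalgebras, every representation of `R`
generates `R`. -/
theorem stmt_5 (σ : Signature) (K : Set (UAlgebra σ)) (hKfin : K.Finite)
    (hfin : ∀ A ∈ K, Finite A.carrier) (hne : ∀ A ∈ K, Nonempty A.carrier)
    (hid : ∀ A ∈ K, A.Idempotent) (hsm : ∀ A ∈ K, A.IsSmooth)
    (h1 : ∀ A ∈ K, A.OmitsType1) (hsf : ∀ A ∈ K, A.SemilatticeFree)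
    (hsubcl : ∀ A ∈ K, ∀ (S : Set A.carrier) (hS : A.IsClosed S),
      S.Nonempty → A.subalg S hS ∈ K)
    (n : ℕ) (A : Fin n → UAlgebra σ) (hA : ∀ i, A i ∈ K)
    (R : Set (UAlgebra.pi A).carrier) (hRcl : (UAlgebra.pi A).IsClosed R)
    (hRne : R.Nonempty)
    (hsubdir : ∀ (i : Fin n) (a : (A i).carrier), ∃ u ∈ R, u i = a)
    (R' : Set (UAlgebra.pi A).carrier) (hR'R : R' ⊆ R)
    -- condition (1) of representations: all of `Sig(R)` is witnessed in `R'`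
    (hrep1 : ∀ (i : Fin n) (a b : (A i).carrier),
      (a = b ∨ IsThinAffEdge (QuotSubClass K) (A i) a b) →
      (∃ u ∈ R, ∃ v ∈ R, u i = a ∧ v i = b ∧ ∀ j : Fin n, j < i → u j = v j) →
      (∃ u ∈ R', ∃ v ∈ R', u i = a ∧ v i = b ∧ ∀ j : Fin n, j < i → u j = v j))
    -- condition (2) of representations: projections on at most 3 coordinates
    (hrep2 : ∀ I : Finset (Fin n), I.card ≤ 3 →
      ∀ u ∈ R, ∃ v ∈ R', ∀ i ∈ I, v i = u i) :
    (UAlgebra.pi A).ClosureSet R' = R := by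
  obtain ⟨m, E, -, rfl⟩ := hKfin.fin_param
  choose k hk using hA
  obtain rfl : (fun i => E (k i)) = A := funext hk
  have hfin' : ∀ k, Finite (E k).carrier := fun k => hfin _ ⟨k, rfl⟩
  exact UAlgebra.closureSet_eq_of_representation hfin' (fun k => hid _ ⟨k, rfl⟩)
    (fun k => (hsf _ ⟨k, rfl⟩).slf (hid _ ⟨k, rfl⟩)) (fun k => h1 _ ⟨k, rfl⟩) hRcl hR'R
    (fun i a b h => hrep1 i a b (Or.inr h)) hrep2
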